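/- Let (Ω, C, Λ) be a naive convex co-compact triple such that cdim_{F_Ω(x)}(∂_i C ∩ F_Ω(x)) ≤ 1 for all x ∈ ∂_i C. Then there exists R > 0 such that for every properly embedded two-dimensional simplex S ⊂ C and every vertex a of S, diam_{F_Ω(a)}(∂_i C ∩ F_Ω(a)) ≤ R, where the diameter is with respect to the Hilbert metric of the face F_Ω(a). -/

import Mathlib

open Set Filter

noncomputable section

/-- Real projective space `P(ℝ^d)`, with the quotient topology. -/
abbrev PSpace (d : ℕ) := Projectivization ℝ (Fin d → ℝ)

instance PSpace.instTopologicalSpace (d : ℕ) : TopologicalSpace (PSpace d) :=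
  inferInstanceAs (TopologicalSpace (Quotient (projectivizationSetoid ℝ (Fin d → ℝ))))

namespace Paper

variable {d : ℕ}

/-- Inhomogeneous coordinates in the affine chart determined by the linear functional `f`:
a projective point `[v]` with `f v ≠ 0` is sent to the representative `v / f v` lying in the
affine hyperplane `{f = 1}`. -/
def chartMap (f : (Fin d → ℝ) →ₗ[ℝ] ℝ) (x : PSpace d) : Fin d → ℝ :=
  (f x.rep)⁻¹ • x.rep

/-- A subset of `P(ℝ^d)` is properly convex if there is an affine chart in which it is a
bounded convex set. -/
def IsProperlyConvex (C : Set (PSpace d)) : Prop :=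
  ∃ f : (Fin d → ℝ) →ₗ[ℝ] ℝ, (∀ x ∈ closure C, f x.rep ≠ 0) ∧
    Convex ℝ (chartMap f '' C) ∧ Bornology.IsBounded (chartMap f '' C)

/-- A properly convex domain: an open, nonempty, properly convex subset of `P(ℝ^d)`. -/
def IsPCDomain (Ω : Set (PSpace d)) : Prop :=
  IsOpen Ω ∧ Ω.Nonempty ∧ IsProperlyConvex Ω

open Classical in
/-- A choice of an affine chart containing the properly convex set `C`. -/
def chartOf (C : Set (PSpace d)) : (Fin d → ℝ) →ₗ[ℝ] ℝ :=
  if h : IsProperlyConvex C then h.choose else 0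

/-- The chart map associated to the chosen chart of `C`. -/
def cmap (C : Set (PSpace d)) : PSpace d → Fin d → ℝ := chartMap (chartOf C)

/-- The Hilbert distance between `u` and `v` computed in an affine chart where the convex set
is `O`: writing the line through `u, v` as `t ↦ u + t(v-u)`, with boundary parameters
`tm = inf {t | u + t(v-u) ∈ O} ≤ 0` and `tp = sup {...} ≥ 1`, the cross-ratio
`[a,u,v,b]` of `a = u + tm(v-u), u, v, b = u + tp(v-u)` equals `(tp(1-tm))/((-tm)(tp-1))`. -/
def hilbertDistChart (O : Set (Fin d → ℝ)) (u v : Fin d → ℝ) : ℝ :=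
  if u = v then 0
  else
    (1 / 2) * Real.log
      ((sSup {t : ℝ | u + t • (v - u) ∈ O} * (1 - sInf {t : ℝ | u + t • (v - u) ∈ O})) /
        ((-(sInf {t : ℝ | u + t • (v - u) ∈ O})) * (sSup {t : ℝ | u + t • (v - u) ∈ O} - 1)))

/-- The Hilbert metric of a properly convex set `C` (open in its span). -/
def hilbertDist (C : Set (PSpace d)) (x y : PSpace d) : ℝ :=
  hilbertDistChart (cmap C '' C) (cmap C x) (cmap C y)

/-- The closed projective line segment `[x,y]` contained in `closure C`. -/
def projSeg (C : Set (PSpace d)) (x y : PSpace d) : Set (PSpace d) :=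
  {z ∈ closure C | cmap C z ∈ segment ℝ (cmap C x) (cmap C y)}

/-- The open projective line segment `(x,y)` contained in `closure C`. -/
def projOpenSeg (C : Set (PSpace d)) (x y : PSpace d) : Set (PSpace d) :=
  {z ∈ closure C | cmap C z ∈ openSegment ℝ (cmap C x) (cmap C y)}

/-- The open face `F_C(x)` of a point `x ∈ closure C`: the set `{x}` together with all
`y ∈ closure C` such that some open line segment contained in `closure C` contains
both `x` and `y`. -/
def face (C : Set (PSpace d)) (x : PSpace d) : Set (PSpace d) :=
  insert x {y ∈ closure C | ∃ a ∈ closure C, ∃ b ∈ closure C,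
    x ∈ projOpenSeg C a b ∧ y ∈ projOpenSeg C a b}

/-- The ideal boundary `∂_i C = closure C \ C`. -/
def idealBdry (C : Set (PSpace d)) : Set (PSpace d) := closure C \ C

/-- The dimension of a subset `B`, computed in the chart of the ambient convex set `C`. -/
def pdimIn (C B : Set (PSpace d)) : ℕ :=
  Module.finrank ℝ (affineSpan ℝ (cmap C '' B)).direction

/-- The dimension of a convex subset of `P(ℝ^d)`. -/
def pdim (A : Set (PSpace d)) : ℕ := pdimIn A A

/-- The coarse dimension `cdim_C(A)` of a nonempty subset `A` of a properly convex set `C`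
open in its span: the smallest `k` such that `A` is contained in an `R`-neighborhood (for the
Hilbert metric of `C`) of a `k`-dimensional convex subset `B ⊆ C`. -/
def cdim (C A : Set (PSpace d)) : ℕ :=
  sInf {k : ℕ | ∃ R : ℝ, 0 < R ∧ ∃ B : Set (PSpace d), B ⊆ C ∧
    Convex ℝ (cmap C '' B) ∧ pdimIn C B = k ∧
    A ⊆ {p ∈ C | ∃ q ∈ B, hilbertDist C p q < R}}

/-- The cone over the standard open `(p-1)`-dimensional simplex: vectors whose first `p`
coordinates are positive and whose remaining coordinates vanish. -/
def simplexCone (p : ℕ) : Set (Fin d → ℝ) :=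
  {v | (∀ i : Fin d, (i : ℕ) < p → 0 < v i) ∧ ∀ i : Fin d, p ≤ (i : ℕ) → v i = 0}

/-- `S` is the image under `g ∈ PGL_d(ℝ)` of the standard open simplex with `p` vertices. -/
def IsSimplexWithMap (p : ℕ) (S : Set (PSpace d)) (g : (Fin d → ℝ) ≃ₗ[ℝ] (Fin d → ℝ)) : Prop :=
  S = {q : PSpace d | ∃ v ∈ simplexCone (d := d) p, ∃ hv : v ≠ 0,
        q = Projectivization.mk ℝ (g v) (by simpa using hv)}

/-- `S ⊆ P(ℝ^d)` is a simplex of dimension `k`. -/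
def IsSimplexOfDim (k : ℕ) (S : Set (PSpace d)) : Prop :=
  k + 1 ≤ d ∧ ∃ g : (Fin d → ℝ) ≃ₗ[ℝ] (Fin d → ℝ), IsSimplexWithMap (k + 1) S g

/-- `S` is a simplex with vertices `v 0, …, v (p-1)` (so of dimension `p - 1`). -/
def HasVertices {p : ℕ} (S : Set (PSpace d)) (v : Fin p → PSpace d) : Prop :=
  ∃ (hp : p ≤ d) (g : (Fin d → ℝ) ≃ₗ[ℝ] (Fin d → ℝ)),
    IsSimplexWithMap p S g ∧
    ∀ j : Fin p, v j = Projectivization.mk ℝ (g (Pi.single (Fin.castLE hp j) 1))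
      (by
        simp only [ne_eq, EmbeddingLike.map_eq_zero_iff]
        intro h
        have h1 := congrFun h (Fin.castLE hp j)
        rw [Pi.single_eq_same] at h1
        exact one_ne_zero (α := ℝ) h1)

/-- `A ⊆ B` is properly embedded if the inclusion map `A ↪ B` is proper. -/
def IsProperlyEmbedded (A B : Set (PSpace d)) : Prop :=
  ∃ h : A ⊆ B, IsProperMap (Set.inclusion h)

/-- The projective action of `GL(ℝ^d)` (hence of `PGL_d(ℝ)`) on `P(ℝ^d)`. -/
def pact (g : (Fin d → ℝ) ≃ₗ[ℝ] (Fin d → ℝ)) : PSpace d → PSpace d :=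
  Projectivization.map g.toLinearMap g.injective

/-- A naive convex co-compact triple `(Ω, C, Λ)`. -/
structure NCCTriple (d : ℕ) where
  Ω : Set (PSpace d)
  C : Set (PSpace d)
  Λ : Subgroup ((Fin d → ℝ) ≃ₗ[ℝ] (Fin d → ℝ))
  isOpen_Ω : IsOpen Ω
  nonempty_Ω : Ω.Nonempty
  properlyConvex_Ω : IsProperlyConvex Ω
  inv_Ω : ∀ g ∈ Λ, pact g '' Ω = Ω
  infinite_Λ : (Λ : Set ((Fin d → ℝ) ≃ₗ[ℝ] (Fin d → ℝ))).Infinite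
  discrete_Λ : ∀ K ⊆ Ω, IsCompact K →
    {g : (Fin d → ℝ) ≃ₗ[ℝ] (Fin d → ℝ) | g ∈ Λ ∧ (pact g '' K ∩ K).Nonempty}.Finite
  C_nonempty : C.Nonempty
  C_sub : C ⊆ Ω
  C_closedInΩ : closure C ∩ Ω ⊆ C
  C_convex : Convex ℝ (cmap Ω '' C)
  inv_C : ∀ g ∈ Λ, pact g '' C = C
  cocompact : ∃ K : Set (PSpace d), K ⊆ C ∧ IsCompact K ∧ C ⊆ ⋃ g ∈ Λ, pact g '' K

/-- The orbit of a point under a subgroup of `PGL_d(ℝ)`. -/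
def porbit (Λ : Subgroup ((Fin d → ℝ) ≃ₗ[ℝ] (Fin d → ℝ))) (p : PSpace d) : Set (PSpace d) :=
  {q | ∃ g ∈ Λ, q = pact g p}

/-- The full orbital limit set `L_Ω(Λ)`. -/
def limitSet (Ω : Set (PSpace d)) (Λ : Subgroup ((Fin d → ℝ) ≃ₗ[ℝ] (Fin d → ℝ))) :
    Set (PSpace d) :=
  ⋃ p ∈ Ω, (closure (porbit Λ p) \ porbit Λ p)

/-- The convex hull of `X ⊆ closure Ω` taken inside `Ω`. -/
def convHullIn (Ω X : Set (PSpace d)) : Set (PSpace d) :=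
  {z ∈ Ω | cmap Ω z ∈ convexHull ℝ (cmap Ω '' X)}

/-- `C_Ω(Λ)`: the convex hull of the full orbital limit set in `Ω`. -/
def coreC (Ω : Set (PSpace d)) (Λ : Subgroup ((Fin d → ℝ) ≃ₗ[ℝ] (Fin d → ℝ))) :
    Set (PSpace d) :=
  convHullIn Ω (limitSet Ω Λ)

/-- A convex co-compact group `Λ ⊆ Aut(Ω)`: an infinite discrete subgroup preserving `Ω`
such that `C_Ω(Λ)` is nonempty and `Λ` acts cocompactly on it. -/
structure CCSetup (d : ℕ) where
  Ω : Set (PSpace d)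
  Λ : Subgroup ((Fin d → ℝ) ≃ₗ[ℝ] (Fin d → ℝ))
  isOpen_Ω : IsOpen Ω
  nonempty_Ω : Ω.Nonempty
  properlyConvex_Ω : IsProperlyConvex Ω
  inv_Ω : ∀ g ∈ Λ, pact g '' Ω = Ω
  infinite_Λ : (Λ : Set ((Fin d → ℝ) ≃ₗ[ℝ] (Fin d → ℝ))).Infinite
  discrete_Λ : ∀ K ⊆ Ω, IsCompact K →
    {g : (Fin d → ℝ) ≃ₗ[ℝ] (Fin d → ℝ) | g ∈ Λ ∧ (pact g '' K ∩ K).Nonempty}.Finite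
  core_nonempty : (coreC Ω Λ).Nonempty
  cocompact : ∃ K : Set (PSpace d), K ⊆ coreC Ω Λ ∧ IsCompact K ∧
    coreC Ω Λ ⊆ ⋃ g ∈ Λ, pact g '' K

/-- The Gromov product of `x, y` at `w`, with respect to the Hilbert metric of `Ω`. -/
def gromovProd (Ω : Set (PSpace d)) (w x y : PSpace d) : ℝ :=
  (hilbertDist Ω x w + hilbertDist Ω y w - hilbertDist Ω x y) / 2

/-- `(C, d_Ω)` is Gromov hyperbolic. -/
def GromovHyperbolicOn (Ω C : Set (PSpace d)) : Prop :=
  ∃ δ : ℝ, 0 ≤ δ ∧ ∀ x ∈ C, ∀ y ∈ C, ∀ z ∈ C, ∀ w ∈ C,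
    min (gromovProd Ω w x y) (gromovProd Ω w y z) - δ ≤ gromovProd Ω w x z

/-- The open Hilbert-metric ball in `Ω`. -/
def hBall (Ω : Set (PSpace d)) (x : PSpace d) (r : ℝ) : Set (PSpace d) :=
  {y ∈ Ω | hilbertDist Ω x y < r}

/-- The Hausdorff distance between `A` and `B` (w.r.t. the Hilbert metric of `Ω`)
is less than `ε`. -/
def hausLT (Ω A B : Set (PSpace d)) (ε : ℝ) : Prop :=
  (∀ a ∈ A, ∃ b ∈ B, hilbertDist Ω a b < ε) ∧ ∀ b ∈ B, ∃ a ∈ A, hilbertDist Ω a b < ε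

/-- The Hausdorff distance between `A` and `B` (w.r.t. the Hilbert metric of `Ω`)
is at most `r`. -/
def hausdorffDistLE (Ω A B : Set (PSpace d)) (r : ℝ) : Prop :=
  ∀ ε : ℝ, 0 < ε → hausLT Ω A B (r + ε)

/-- Convergence `F n → C` in the local Hausdorff topology induced by `d_Ω`. -/
def LocalHausConv (Ω : Set (PSpace d)) (F : ℕ → Set (PSpace d)) (C : Set (PSpace d)) : Prop :=
  ∀ x ∈ Ω, ∀ r : ℝ, 0 < r → ∀ ε : ℝ, 0 < ε →
    ∀ᶠ n in atTop, hausLT Ω (F n ∩ hBall Ω x r) (C ∩ hBall Ω x r) ε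

/-- A collection `𝒮` of closed subsets of `Ω` is closed and discrete in the local Hausdorff
topology: any sequence in `𝒮` converging to a nonempty closed subset of `Ω` has limit in `𝒮`
and is eventually equal to its limit. -/
def ClosedAndDiscreteInLHT (Ω : Set (PSpace d)) (𝒮 : Set (Set (PSpace d))) : Prop :=
  ∀ F : ℕ → Set (PSpace d), (∀ n, F n ∈ 𝒮) →
    ∀ C : Set (PSpace d), C.Nonempty → C ⊆ Ω → closure C ∩ Ω ⊆ C → LocalHausConv Ω F C →
      C ∈ 𝒮 ∧ ∀ᶠ n in atTop, F n = C


set_option linter.unusedSectionVars false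
/-- A sharp open convex cone with a positive functional. -/
structure ConeData (V : Type*) [NormedAddCommGroup V] [NormedSpace ℝ V] where
  K0 : Set V
  f : V →ₗ[ℝ] ℝ
  M : ℝ
  isOpen : IsOpen K0
  nonempty : K0.Nonempty
  smul_mem : ∀ t : ℝ, 0 < t → ∀ v ∈ K0, t • v ∈ K0
  add_mem : ∀ v ∈ K0, ∀ w ∈ K0, v + w ∈ K0
  pos : ∀ v ∈ K0, 0 < f v
  bound : ∀ v ∈ K0, ‖v‖ ≤ M * f v

namespace ConeData
variable {V : Type*} [NormedAddCommGroup V] [NormedSpace ℝ V] [FiniteDimensional ℝ V]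
variable (D : ConeData V)

def K : Set V := closure D.K0

def N (E : ℝ) (x y : V) : Prop :=
  ∃ α β : ℝ, 0 < α ∧ 0 < β ∧ α * β ≤ E ∧ α • y - x ∈ D.K ∧ β • x - y ∈ D.K

lemma fcont : Continuous D.f := LinearMap.continuous_of_finiteDimensional _

lemma K0_sub : D.K0 ⊆ D.K := subset_closure

lemma K_closed : IsClosed D.K := isClosed_closure

lemma K_add {x y : V} (hx : x ∈ D.K) (hy : y ∈ D.K) : x + y ∈ D.K :=
  map_mem_closure₂ continuous_add hx hy (fun a ha b hb => D.add_mem a ha b hb)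

lemma K_zero : (0 : V) ∈ D.K := by
  obtain ⟨v, hv⟩ := D.nonempty
  have h : Tendsto (fun t : ℝ => t • v) (nhdsWithin 0 (Ioi 0)) (nhds ((0:ℝ) • v)) :=
    ((continuous_id.smul continuous_const).tendsto 0).mono_left nhdsWithin_le_nhds
  rw [zero_smul] at h
  refine mem_closure_of_tendsto h ?_
  filter_upwards [self_mem_nhdsWithin] with t ht
  exact D.smul_mem t ht v hv

lemma K_smul {t : ℝ} (ht : 0 ≤ t) {x : V} (hx : x ∈ D.K) : t • x ∈ D.K := by
  rcases ht.eq_or_lt with rfl | ht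
  · rw [zero_smul]; exact D.K_zero
  · exact map_mem_closure (continuous_const_smul t) hx (fun a ha => D.smul_mem t ht a ha)

lemma K_bound {x : V} (hx : x ∈ D.K) : ‖x‖ ≤ D.M * D.f x := by
  have : D.K ⊆ {x | ‖x‖ ≤ D.M * D.f x} :=
    closure_minimal (fun v hv => D.bound v hv)
      (isClosed_le continuous_norm (continuous_const.mul D.fcont))
  exact this hx

lemma K_nonneg {x : V} (hx : x ∈ D.K) : 0 ≤ D.f x := by
  have : D.K ⊆ {x | 0 ≤ D.f x} :=
    closure_minimal (fun v hv => (D.pos v hv).le)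
      (isClosed_le continuous_const D.fcont)
  exact this hx

lemma K_pos {x : V} (hx : x ∈ D.K) (h0 : x ≠ 0) : 0 < D.f x := by
  rcases (D.K_nonneg hx).eq_or_lt with h | h
  · have := D.K_bound hx
    rw [← h, mul_zero] at this
    exact absurd (norm_le_zero_iff.1 this) h0
  · exact h

lemma K0_add {x y : V} (hx : x ∈ D.K) (hy : y ∈ D.K0) : x + y ∈ D.K0 := by
  -- choose x' in K0 near x with y - (x' - x) in K0
  have ho : IsOpen {z | x + y - z ∈ D.K0} := D.isOpen.preimage (by fun_prop)
  have hm : x ∈ {z | x + y - z ∈ D.K0} := by simpa using hy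
  obtain ⟨z, hz1, hz2⟩ := mem_closure_iff.1 hx _ ho hm
  have := D.add_mem _ hz1 _ hz2
  simpa using this

lemma K0_of_le {x y : V} {c : ℝ} (hc : 0 < c) (hy : y ∈ D.K0) (h : c • x - y ∈ D.K) :
    x ∈ D.K0 := by
  have h1 := D.K0_add h hy
  have h2 := D.smul_mem c⁻¹ (inv_pos.2 hc) _ h1
  rwa [sub_add_cancel, smul_smul, inv_mul_cancel₀ hc.ne', one_smul] at h2

/-- interior points dominate everything -/
lemma K0_dom {x : V} (y : V) (hx : x ∈ D.K0) : ∃ c : ℝ, 0 < c ∧ c • x - y ∈ D.K0 := by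
  have ho : IsOpen {t : ℝ | x - t • y ∈ D.K0} := D.isOpen.preimage (by fun_prop)
  have hm : (0:ℝ) ∈ {t : ℝ | x - t • y ∈ D.K0} := by simpa using hx
  have := (ho.mem_nhds hm)
  obtain ⟨e, he, h⟩ := Metric.mem_nhds_iff.1 this
  have h2 : (e/2) ∈ Metric.ball (0:ℝ) e := by
    simpa [abs_of_pos he] using he
  have h3 := D.smul_mem (e/2)⁻¹ (by positivity) _ (h h2)
  refine ⟨(e/2)⁻¹, by positivity, ?_⟩
  rwa [smul_sub, smul_smul, inv_mul_cancel₀ (by positivity), one_smul] at h3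

/-- supporting functional -/
lemma support {q : V} (hq : q ∈ D.K) (hq0 : q ∉ D.K0) :
    ∃ φ : V →ₗ[ℝ] ℝ, (∀ x ∈ D.K, 0 ≤ φ x) ∧ (∀ x ∈ D.K0, 0 < φ x) ∧ φ q = 0 := by
  have hconv : Convex ℝ D.K0 := by
    intro x hx y hy a b ha hb hab
    rcases ha.eq_or_lt with rfl | ha
    · have : b = 1 := by linarith
      simpa [this] using hy
    rcases hb.eq_or_lt with rfl | hb
    · have : a = 1 := by linarith
      simpa [this] using hx
    exact D.add_mem _ (D.smul_mem a ha x hx) _ (D.smul_mem b hb y hy)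
  obtain ⟨g, hg⟩ := geometric_hahn_banach_open_point hconv D.isOpen hq0
  -- g x < g q on K0
  have hle : ∀ x ∈ D.K, g x ≤ g q := fun x hx =>
    closure_minimal (fun v hv => (hg v hv).le)
      (isClosed_le g.continuous continuous_const) hx
  have h0 : 0 ≤ g q := by simpa using hle 0 D.K_zero
  have h1 : g q ≤ 0 := by
    have := hle ((2:ℝ) • q) (D.K_smul (by norm_num) hq)
    rw [map_smul, smul_eq_mul] at this; linarith
  have h2 : g q = 0 := le_antisymm h1 h0
  refine ⟨-(g : V →ₗ[ℝ] ℝ), fun x hx => ?_, fun x hx => ?_, ?_⟩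
  · have := hle x hx; simp; linarith
  · have := hg x hx; simp; linarith
  · simp [h2]

/-! ### the relation N -/
variable {D}
lemma N.symm {E : ℝ} {x y : V} (h : D.N E x y) : D.N E y x := by
  obtain ⟨α, β, h1, h2, h3, h4, h5⟩ := h
  exact ⟨β, α, h2, h1, by linarith, h5, h4⟩

lemma N.mono {E E' : ℝ} {x y : V} (h : D.N E x y) (hE : E ≤ E') : D.N E' x y := by
  obtain ⟨α, β, h1, h2, h3, h4, h5⟩ := h
  exact ⟨α, β, h1, h2, by linarith, h4, h5⟩

lemma N.trans {E E' : ℝ} {x y z : V} (h : D.N E x y) (h' : D.N E' y z) : D.N (E * E') x z := by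
  obtain ⟨α, β, h1, h2, h3, h4, h5⟩ := h
  obtain ⟨α', β', h1', h2', h3', h4', h5'⟩ := h'
  refine ⟨α * α', β * β', by positivity, by positivity, ?_, ?_, ?_⟩
  · calc α * α' * (β * β') = (α * β) * (α' * β') := by ring
      _ ≤ E * E' := mul_le_mul h3 h3' (by positivity) (le_trans (by positivity) h3)
  · have := D.K_add (D.K_smul h1.le h4') h4
    convert this using 1; module
  · have := D.K_add (D.K_smul h2'.le h5) h5'
    convert this using 1; module

lemma N.smul_right {E : ℝ} {x y : V} (h : D.N E x y) {t : ℝ} (ht : 0 < t) : D.N E x (t • y) := by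
  obtain ⟨α, β, h1, h2, h3, h4, h5⟩ := h
  refine ⟨α / t, β * t, by positivity, by positivity, ?_, ?_, ?_⟩
  · rwa [show α / t * (β * t) = α * β by field_simp]
  · rwa [smul_smul, div_mul_cancel₀ _ ht.ne']
  · convert D.K_smul ht.le h5 using 1; module

lemma N.smul_left {E : ℝ} {x y : V} (h : D.N E x y) {t : ℝ} (ht : 0 < t) : D.N E (t • x) y :=
  (h.symm.smul_right ht).symm

lemma N_smul_right_iff {E : ℝ} {x y : V} {t : ℝ} (ht : 0 < t) : D.N E x (t • y) ↔ D.N E x y := by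
  refine ⟨fun h => ?_, fun h => h.smul_right ht⟩
  have := h.smul_right (inv_pos.2 ht)
  rwa [smul_smul, inv_mul_cancel₀ ht.ne', one_smul] at this

lemma N_refl {x : V} : D.N 1 x x :=
  ⟨1, 1, by norm_num, by norm_num, by norm_num, by simpa using D.K_zero, by simpa using D.K_zero⟩

lemma N_closed {E : ℝ} {x y : ℕ → V} {x0 y0 : V} (hx : Tendsto x atTop (nhds x0))
    (hy : Tendsto y atTop (nhds y0)) (hx0 : 0 < D.f x0) (hy0 : 0 < D.f y0)
    (h : ∀ n, D.N E (x n) (y n)) : D.N E x0 y0 := by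
  choose α β h1 h2 h3 h4 h5 using h
  have hfx := (D.fcont.tendsto x0).comp hx
  have hfy := (D.fcont.tendsto y0).comp hy
  have hE : 0 < E := lt_of_lt_of_le (mul_pos (h1 0) (h2 0)) (h3 0)
  -- lower bounds
  have e1 := hfx.eventually (Ioo_mem_nhds (show D.f x0 / 2 < D.f x0 by linarith)
    (show D.f x0 < 2 * D.f x0 by linarith))
  have e2 := hfy.eventually (Ioo_mem_nhds (show D.f y0 / 2 < D.f y0 by linarith)
    (show D.f y0 < 2 * D.f y0 by linarith))
  obtain ⟨n0, hn0⟩ := (e1.and e2).exists_forall_of_atTop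
  set p := D.f x0
  set q := D.f y0
  have hα : ∀ n ≥ n0, p / (4 * q) ≤ α n := by
    intro n hn
    obtain ⟨⟨a1, a2⟩, b1, b2⟩ := hn0 n hn
    simp only [Function.comp] at a1 a2 b1 b2
    have := D.K_nonneg (h4 n)
    rw [map_sub, map_smul, smul_eq_mul] at this
    rw [div_le_iff₀ (by positivity)]
    nlinarith [h1 n]
  have hβ : ∀ n ≥ n0, q / (4 * p) ≤ β n := by
    intro n hn
    obtain ⟨⟨a1, a2⟩, b1, b2⟩ := hn0 n hn
    simp only [Function.comp] at a1 a2 b1 b2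
    have := D.K_nonneg (h5 n)
    rw [map_sub, map_smul, smul_eq_mul] at this
    rw [div_le_iff₀ (by positivity)]
    nlinarith [h2 n]
  have hα' : ∀ n ≥ n0, α n ≤ E / (q / (4 * p)) := by
    intro n hn
    rw [le_div_iff₀ (by positivity)]
    exact le_trans (mul_le_mul_of_nonneg_left (hβ n hn) (h1 n).le) (h3 n)
  have hβ' : ∀ n ≥ n0, β n ≤ E / (p / (4 * q)) := by
    intro n hn
    rw [le_div_iff₀ (by positivity), mul_comm]
    exact le_trans (mul_le_mul_of_nonneg_right (hα n hn) (h2 n).le) (h3 n)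
  have hcomp : IsCompact ((Icc (p / (4 * q)) (E / (q / (4 * p)))) ×ˢ
      (Icc (q / (4 * p)) (E / (p / (4 * q))))) := isCompact_Icc.prod isCompact_Icc
  obtain ⟨⟨a, b⟩, hab, s, hs, hlim⟩ := hcomp.tendsto_subseq
    (x := fun n => (α (n + n0), β (n + n0)))
    (fun n => ⟨⟨hα _ (by omega), hα' _ (by omega)⟩, hβ _ (by omega), hβ' _ (by omega)⟩)
  have la : Tendsto (fun n => α (s n + n0)) atTop (nhds a) :=
    (continuous_fst.tendsto _).comp hlim
  have lb : Tendsto (fun n => β (s n + n0)) atTop (nhds b) :=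
    (continuous_snd.tendsto _).comp hlim
  have hs' : Tendsto (fun n => s n + n0) atTop atTop :=
    (tendsto_add_atTop_nat n0).comp hs.tendsto_atTop
  have lx := hx.comp hs'
  have ly := hy.comp hs'
  refine ⟨a, b, lt_of_lt_of_le (by positivity) hab.1.1, lt_of_lt_of_le (by positivity) hab.2.1,
    ?_, ?_, ?_⟩
  · exact le_of_tendsto (la.mul lb) (Eventually.of_forall fun n => h3 _)
  · exact D.K_closed.mem_of_tendsto ((la.smul ly).sub lx) (Eventually.of_forall fun n => h4 _)
  · exact D.K_closed.mem_of_tendsto ((lb.smul lx).sub ly) (Eventually.of_forall fun n => h5 _)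

end ConeData

namespace ConeData
variable {V : Type*} [NormedAddCommGroup V] [NormedSpace ℝ V] [FiniteDimensional ℝ V]
variable {D : ConeData V}

lemma exists_min {y z : V} (hy : 0 < D.f y) (hz : 0 < D.f z)
    (h : ∃ α : ℝ, α • z - y ∈ D.K) :
    ∃ α0 : ℝ, 0 < α0 ∧ α0 • z - y ∈ D.K ∧ ∀ α : ℝ, α • z - y ∈ D.K → α0 ≤ α := by
  have hc : IsClosed {α : ℝ | α • z - y ∈ D.K} := D.K_closed.preimage (by fun_prop)
  have hb : ∀ α ∈ {α : ℝ | α • z - y ∈ D.K}, D.f y / D.f z ≤ α := by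
    intro α hα
    have := D.K_nonneg hα
    rw [map_sub, map_smul, smul_eq_mul] at this
    rw [div_le_iff₀ hz]; linarith
  have hbb : BddBelow {α : ℝ | α • z - y ∈ D.K} := ⟨_, hb⟩
  have hm := hc.csInf_mem h hbb
  exact ⟨_, lt_of_lt_of_le (by positivity) (hb _ hm), hm, fun α hα => csInf_le hbb hα⟩

lemma midpoint {y z : V} {E E' : ℝ} (hy : 0 < D.f y) (hz : 0 < D.f z)
    (hyK : y ∈ D.K) (hzK : z ∈ D.K)
    (hE : 0 ≤ E) (h' : D.N E' y z) (h : ¬ D.N (E ^ 2) y z) :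
    ∃ s : ℝ, 0 < s ∧ ¬ D.N E (s • y + z) y ∧ ¬ D.N E (s • y + z) z := by
  obtain ⟨a1, b1, -, -, -, ha1, hb1⟩ := h'
  obtain ⟨α0, hα0, hα1, hα2⟩ := exists_min hy hz ⟨a1, ha1⟩
  obtain ⟨β0, hβ0, hβ1, hβ2⟩ := exists_min hz hy ⟨b1, hb1⟩
  have hlt : E ^ 2 < α0 * β0 := by
    by_contra hcon
    exact h ⟨α0, β0, hα0, hβ0, not_lt.1 hcon, hα1, hβ1⟩
  set A := Real.sqrt (α0 * β0) with hA
  have hAE : E < A := (Real.lt_sqrt hE).2 hlt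
  have hA2 : A * A = α0 * β0 := Real.mul_self_sqrt (by positivity)
  have hApos : 0 < A := Real.sqrt_pos.2 (by positivity)
  have hs : 0 < A / α0 := by positivity
  obtain ⟨s, rfl⟩ : ∃ s, s = A / α0 := ⟨_, rfl⟩
  set s := A / α0 with hsdef
  have hs1 : s * α0 = A := by rw [hsdef]; field_simp
  have hs2 : s * A = β0 := by
    have : s * A * α0 = β0 * α0 := by
      calc s * A * α0 = s * α0 * A := by ring
        _ = β0 * α0 := by rw [hs1, hA2]; ring
    exact mul_right_cancel₀ hα0.ne' this
  refine ⟨s, hs, ?_, ?_⟩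
  · rintro ⟨α, β, h1, h2, h3, h4, h5⟩
    have k1 : β0 ≤ α - s := hβ2 _ (by convert h4 using 1; module)
    have k2 : α0 ≤ β * (1 + A) := by
      rcases lt_or_ge (β * s) 1 with hb | hb
      · have hb' : 0 < 1 - β * s := by linarith
        have := hα2 (β / (1 - β * s)) (by
          have := D.K_smul (inv_pos.2 hb').le h5
          convert this using 1
          rw [smul_sub, smul_add, smul_add, smul_smul, smul_smul, smul_smul]
          rw [show ((1 - β * s)⁻¹ * β) = β / (1 - β * s) by rw [mul_comm]; rfl]
          have e : (1 - β * s)⁻¹ • y = y + (β / (1 - β * s)) • s • y := by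
            rw [smul_smul]
            nth_rewrite 2 [← one_smul ℝ y]
            rw [← add_smul]; congr 1; field_simp; ring
          rw [e]
          module)
        rw [le_div_iff₀ hb'] at this
        nlinarith
      · nlinarith
    have k3 : s * (1 + A) ≤ α := by nlinarith
    have : A ≤ α * β := by
      have : s * (1 + A) * β ≤ α * β := mul_le_mul_of_nonneg_right k3 h2.le
      nlinarith
    linarith
  · rintro ⟨α, β, h1, h2, h3, h4, h5⟩
    have k1 : α0 ≤ (α - 1) / s := hα2 _ (by
      have := D.K_smul (inv_pos.2 hs).le h4
      convert this using 1
      have e : s⁻¹ • s • y = y := by rw [smul_smul, inv_mul_cancel₀ hs.ne', one_smul]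
      rw [smul_sub, smul_add, e]
      rw [div_eq_inv_mul]
      module)
    rw [le_div_iff₀ hs] at k1
    have k2 : A ≤ β * (1 + A) := by
      rcases lt_or_ge β 1 with hb | hb
      · have hb' : 0 < 1 - β := by linarith
        have := hβ2 (β * s / (1 - β)) (by
          have := D.K_smul (inv_pos.2 hb').le h5
          convert this using 1
          have e : (1 - β)⁻¹ • z = z + (β / (1 - β)) • z := by
            nth_rewrite 2 [← one_smul ℝ z]
            rw [← add_smul]; congr 1; field_simp; ring
          rw [smul_sub, e, div_eq_inv_mul, div_eq_inv_mul]
          module)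
        rw [le_div_iff₀ hb'] at this
        rw [← hs2] at this
        have : s * (A * (1 - β)) ≤ s * β := by nlinarith
        have := le_of_mul_le_mul_left this hs
        nlinarith
      · nlinarith
    have k3 : 1 + A ≤ α := by nlinarith
    have : A ≤ α * β := by nlinarith
    linarith

/-- step 2 -/
lemma no_close {a b c m y : V} {E E1 E2 l μ ν : ℝ} (haK : a ∈ D.K) (hbK : b ∈ D.K)
    (hcK : c ∈ D.K) (hyK : y ∈ D.K) (habc : a + b + c ∈ D.K0) (hab : a + b ∉ D.K0)
    (hac : a + c ∉ D.K0) (hm : D.N E1 a m) (hy : D.N E2 a y) (hn : ¬ D.N E m y)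
    (hl : 0 ≤ l) (hμ : 0 ≤ μ) (hν : 0 ≤ ν) (h0 : l • y + μ • b + ν • c ≠ 0) :
    ¬ D.N E m (l • y + μ • b + ν • c) := by
  intro h
  have hq := hm.trans h
  obtain ⟨α, β, h1, h2, h3, h4, h5⟩ := hq
  -- h5 : β • a - q ∈ K
  have hμ0 : μ = 0 := by
    by_contra hne
    have hμ' : 0 < μ := lt_of_le_of_ne hμ (Ne.symm hne)
    apply hac
    refine D.K0_of_le (c := 1 + β / μ) (by positivity) habc ?_
    have k1 : (β / μ) • a - b ∈ D.K := by
      have : β • a - μ • b ∈ D.K := by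
        have := D.K_add h5 (D.K_add (D.K_smul hl hyK) (D.K_smul hν hcK))
        convert this using 1; module
      have := D.K_smul (inv_pos.2 hμ').le this
      convert this using 1
      rw [smul_sub, smul_smul, smul_smul, inv_mul_cancel₀ hμ'.ne', one_smul, div_eq_inv_mul]
    have := D.K_add k1 (D.K_smul (show 0 ≤ β / μ by positivity) hcK)
    convert this using 1; module
  have hν0 : ν = 0 := by
    by_contra hne
    have hν' : 0 < ν := lt_of_le_of_ne hν (Ne.symm hne)
    apply hab
    refine D.K0_of_le (c := 1 + β / ν) (by positivity) habc ?_
    have k1 : (β / ν) • a - c ∈ D.K := by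
      have : β • a - ν • c ∈ D.K := by
        have := D.K_add h5 (D.K_add (D.K_smul hl hyK) (D.K_smul hμ hbK))
        convert this using 1; module
      have := D.K_smul (inv_pos.2 hν').le this
      convert this using 1
      rw [smul_sub, smul_smul, smul_smul, inv_mul_cancel₀ hν'.ne', one_smul, div_eq_inv_mul]
    have := D.K_add k1 (D.K_smul (show 0 ≤ β / ν by positivity) hbK)
    convert this using 1; module
  subst hμ0; subst hν0
  have hl' : 0 < l := by
    rcases hl.eq_or_lt with rfl | hl
    · simp at h0
    · exact hl
  apply hn
  simp only [zero_smul, add_zero] at h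
  exact (N_smul_right_iff hl').1 h

/-- step 3 -/
lemma eventually_far {a b c m y : V} {E E1 E2 : ℝ} (haK : a ∈ D.K) (hbK : b ∈ D.K)
    (hcK : c ∈ D.K) (hyK : y ∈ D.K) (habc : a + b + c ∈ D.K0) (hab : a + b ∉ D.K0)
    (hac : a + c ∉ D.K0) (hm : D.N E1 a m) (hy : D.N E2 a y) (hn : ¬ D.N E m y)
    (fb : 0 < D.f b) (fc : 0 < D.f c) (fm : 0 < D.f m) (fy : 0 < D.f y) :
    ∀ᶠ n : ℕ in atTop, ∀ l μ ν : ℝ, 0 ≤ l → 0 ≤ μ → 0 ≤ ν → l • y + μ • b + ν • c ≠ 0 →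
      ¬ D.N E (m + (1 / ((n : ℝ) + 1)) • (b + c)) (l • y + μ • b + ν • c) := by
  by_contra hcon
  rw [Filter.not_eventually] at hcon
  obtain ⟨s, hs, h⟩ := extraction_of_frequently_atTop hcon
  push Not at h
  choose l μ ν hl hμ hν h0 h using h
  have hsum : ∀ n, 0 < l n + μ n + ν n := by
    intro n
    by_contra hle
    have h1 : l n = 0 := by linarith [hl n, hμ n, hν n]
    have h2 : μ n = 0 := by linarith [hl n, hμ n, hν n]
    have h3 : ν n = 0 := by linarith [hl n, hμ n, hν n]
    exact h0 n (by simp [h1, h2, h3])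
  set S := fun n => (l n + μ n + ν n)⁻¹ with hS
  have hSpos : ∀ n, 0 < S n := fun n => inv_pos.2 (hsum n)
  have hS1 : ∀ n, S n * l n + S n * μ n + S n * ν n = 1 := by
    intro n
    rw [← mul_add, ← mul_add]
    exact inv_mul_cancel₀ (hsum n).ne'
  have hcomp : IsCompact ((Icc (0:ℝ) 1) ×ˢ (Icc (0:ℝ) 1) ×ˢ (Icc (0:ℝ) 1)) :=
    isCompact_Icc.prod (isCompact_Icc.prod isCompact_Icc)
  have p1 : ∀ n, 0 ≤ S n * l n := fun n => mul_nonneg (hSpos n).le (hl n)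
  have p2 : ∀ n, 0 ≤ S n * μ n := fun n => mul_nonneg (hSpos n).le (hμ n)
  have p3 : ∀ n, 0 ≤ S n * ν n := fun n => mul_nonneg (hSpos n).le (hν n)
  obtain ⟨⟨l0, μ0, ν0⟩, hlim0, r, hr, hlim⟩ := hcomp.tendsto_subseq
    (x := fun n => (S n * l n, S n * μ n, S n * ν n))
    (fun n => ⟨⟨p1 n, by linarith [p1 n, p2 n, p3 n, hS1 n]⟩,
      ⟨p2 n, by linarith [p1 n, p2 n, p3 n, hS1 n]⟩,
      ⟨p3 n, by linarith [p1 n, p2 n, p3 n, hS1 n]⟩⟩)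
  have t1 : Tendsto (fun n => S (r n) * l (r n)) atTop (nhds l0) :=
    (continuous_fst.tendsto _).comp hlim
  have t2 : Tendsto (fun n => S (r n) * μ (r n)) atTop (nhds μ0) :=
    ((continuous_fst.comp continuous_snd).tendsto _).comp hlim
  have t3 : Tendsto (fun n => S (r n) * ν (r n)) atTop (nhds ν0) :=
    ((continuous_snd.comp continuous_snd).tendsto _).comp hlim
  have hsum0 : l0 + μ0 + ν0 = 1 :=
    tendsto_nhds_unique ((t1.add t2).add t3) (by simp [hS1])
  obtain ⟨⟨q1, -⟩, ⟨q2, -⟩, ⟨q3, -⟩⟩ := hlim0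
  simp only at q1 q2 q3
  have tq : Tendsto (fun n => (S (r n) * l (r n)) • y + (S (r n) * μ (r n)) • b
      + (S (r n) * ν (r n)) • c) atTop (nhds (l0 • y + μ0 • b + ν0 • c)) :=
    ((t1.smul_const y).add (t2.smul_const b)).add (t3.smul_const c)
  have tp : Tendsto (fun n => m + (1 / ((s (r n) : ℝ) + 1)) • (b + c)) atTop (nhds m) := by
    have e : Tendsto (fun n => 1 / ((s (r n) : ℝ) + 1)) atTop (nhds 0) :=
      tendsto_one_div_add_atTop_nhds_zero_nat.comp (hs.comp hr).tendsto_atTop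
    simpa using (e.smul_const (b + c)).const_add m
  have fq : 0 < D.f (l0 • y + μ0 • b + ν0 • c) := by
    simp only [map_add, map_smul, smul_eq_mul]
    have : 0 < l0 ∨ 0 < μ0 ∨ 0 < ν0 := by
      by_contra hh
      push Not at hh
      linarith [hh.1, hh.2.1, hh.2.2]
    rcases this with h | h | h <;> positivity
  have hN := N_closed (E := E) tp tq fm fq (fun n => by
    have := (h (r n)).smul_right (hSpos (r n))
    convert this using 1
    module)
  refine no_close haK hbK hcK hyK habc hab hac hm hy hn q1 q2 q3 ?_ hN
  intro hz
  rw [hz] at fq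
  simp at fq

end ConeData

namespace ConeData
variable {V : Type*} [NormedAddCommGroup V] [NormedSpace ℝ V] [FiniteDimensional ℝ V]
variable {D : ConeData V}

def Bad (D : ConeData V) (Q P : Set V) (E : ℝ) (Y : Fin 4 → V) (t : Fin 4 → ℝ) : Prop :=
  (∀ i, Y i ∈ Q ∧ D.f (Y i) = 1) ∧ (∀ i, 0 ≤ t i) ∧ ∑ i, t i • Y i ∈ P ∧
  Y 0 + Y 1 + Y 2 ∉ D.K0 ∧ Y 0 + Y 1 + Y 3 ∉ D.K0 ∧
  ¬ D.N E (∑ i, t i • Y i) (Y 0 + Y 2 + Y 3) ∧ ¬ D.N E (∑ i, t i • Y i) (Y 1 + Y 2 + Y 3)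

lemma section_compact (D : ConeData V) {Q : Set V} (hQK : Q ⊆ D.K) (hQc : IsClosed Q) :
    IsCompact {v | v ∈ Q ∧ D.f v = 1} := by
  apply Metric.isCompact_of_isClosed_isBounded
  · exact hQc.inter (isClosed_eq D.fcont continuous_const)
  · refine (Metric.isBounded_closedBall (x := (0:V)) (r := D.M)).subset ?_
    rintro v ⟨hv, hf⟩
    have := D.K_bound (hQK hv)
    rw [hf, mul_one] at this
    simpa using this

lemma far_limit {x y : ℕ → V} {x0 y0 : V} (hx : Tendsto x atTop (nhds x0))
    (hy : Tendsto y atTop (nhds y0)) (hx0 : x0 ∈ D.K0) {e : ℕ → ℝ} (he : Tendsto e atTop atTop)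
    (h : ∀ n, ¬ D.N (e n) (x n) (y n)) : y0 ∉ D.K0 := by
  intro hy0
  obtain ⟨α, hα, h1⟩ := D.K0_dom x0 hy0
  obtain ⟨β, hβ, h2⟩ := D.K0_dom y0 hx0
  have e1 := ((hy.const_smul α).sub hx).eventually (D.isOpen.mem_nhds h1)
  have e2 := ((hx.const_smul β).sub hy).eventually (D.isOpen.mem_nhds h2)
  obtain ⟨n, h3, h4, h5⟩ := (e1.and (e2.and (he.eventually_ge_atTop (α * β)))).exists
  exact h n ⟨α, β, hα, hβ, h5, D.K0_sub h3, D.K0_sub h4⟩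

lemma bad_limit (D : ConeData V) (Q P : Set V) (hQK : Q ⊆ D.K) (hQc : IsClosed Q)
    (hP : IsCompact P) (hPK : P ⊆ D.K0) (h : ∀ n : ℕ, ∃ Y t, Bad D Q P n Y t) :
    ∃ Y : Fin 4 → V, (∀ i, Y i ∈ Q) ∧ ∃ p ∈ D.K0, ∃ t : Fin 4 → ℝ, p = ∑ i, t i • Y i ∧
      Y 0 + Y 1 + Y 2 ∉ D.K0 ∧ Y 0 + Y 1 + Y 3 ∉ D.K0 ∧ Y 0 + Y 2 + Y 3 ∉ D.K0 ∧
      Y 1 + Y 2 + Y 3 ∉ D.K0 := by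
  choose Y t h1 h2 h3 h4 h5 h6 h7 using h
  obtain ⟨B, hB⟩ : ∃ B, ∀ p ∈ P, D.f p ≤ B := by
    obtain ⟨B, hB⟩ := (hP.image D.fcont).bddAbove
    exact ⟨B, fun p hp => hB ⟨p, hp, rfl⟩⟩
  have hcomp : IsCompact ((Set.pi univ fun _ : Fin 4 => {v | v ∈ Q ∧ D.f v = 1}) ×ˢ
      (Set.pi univ fun _ : Fin 4 => Icc (0:ℝ) B)) :=
    (isCompact_univ_pi fun _ => D.section_compact hQK hQc).prod
      (isCompact_univ_pi fun _ => isCompact_Icc)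
  have ht : ∀ n i, t n i ≤ B := by
    intro n i
    have := hB _ (h3 n)
    rw [map_sum] at this
    simp only [map_smul, (h1 n _).2, smul_eq_mul, mul_one] at this
    exact le_trans (Finset.single_le_sum (fun j _ => h2 n j) (Finset.mem_univ i)) this
  obtain ⟨⟨Y0, t0⟩, hlim0, s, hs, hlim⟩ := hcomp.tendsto_subseq (x := fun n => (Y n, t n))
    (fun n => ⟨fun i _ => h1 n i, fun i _ => ⟨h2 n i, ht n i⟩⟩)
  have lY : ∀ i, Tendsto (fun n => Y (s n) i) atTop (nhds (Y0 i)) := fun i =>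
    (((continuous_apply i).comp continuous_fst).tendsto _).comp hlim
  have lt : ∀ i, Tendsto (fun n => t (s n) i) atTop (nhds (t0 i)) := fun i =>
    (((continuous_apply i).comp continuous_snd).tendsto _).comp hlim
  have lp : Tendsto (fun n => ∑ i, t (s n) i • Y (s n) i) atTop (nhds (∑ i, t0 i • Y0 i)) :=
    tendsto_finsetSum _ fun i _ => (lt i).smul (lY i)
  have hpP : ∑ i, t0 i • Y0 i ∈ P :=
    hP.isClosed.mem_of_tendsto lp (Eventually.of_forall fun n => h3 _)
  have hcl : IsClosed (D.K0)ᶜ := D.isOpen.isClosed_compl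
  have hes : Tendsto (fun n => ((s n : ℕ) : ℝ)) atTop atTop :=
    tendsto_natCast_atTop_atTop.comp hs.tendsto_atTop
  refine ⟨Y0, fun i => (hlim0.1 i trivial).1, _, hPK hpP, t0, rfl, ?_, ?_, ?_, ?_⟩
  · exact hcl.mem_of_tendsto (((lY 0).add (lY 1)).add (lY 2)) (Eventually.of_forall fun n => h4 _)
  · exact hcl.mem_of_tendsto (((lY 0).add (lY 1)).add (lY 3)) (Eventually.of_forall fun n => h5 _)
  · exact far_limit lp (((lY 0).add (lY 2)).add (lY 3)) (hPK hpP) hes (fun n => h6 _)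
  · exact far_limit lp (((lY 1).add (lY 2)).add (lY 3)) (hPK hpP) hes (fun n => h7 _)

/-- functional isolating one vertex -/
lemma isolate (D : ConeData V) {x a b c p : V} {t1 t2 t3 t4 : ℝ} (ha : a ∈ D.K) (hb : b ∈ D.K)
    (hc : c ∈ D.K) (hx : x ∈ D.K) (hp : p ∈ D.K0)
    (he : p = t1 • x + t2 • a + t3 • b + t4 • c) (h : a + b + c ∉ D.K0) :
    ∃ φ : V →ₗ[ℝ] ℝ, (∀ v ∈ D.K, 0 ≤ φ v) ∧ φ a = 0 ∧ φ b = 0 ∧ φ c = 0 ∧ 0 < φ x := by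
  obtain ⟨φ, h1, h2, h3⟩ := D.support (D.K_add (D.K_add ha hb) hc) h
  rw [map_add, map_add] at h3
  have ha0 : φ a = 0 := by linarith [h1 a ha, h1 b hb, h1 c hc]
  have hb0 : φ b = 0 := by linarith [h1 a ha, h1 b hb, h1 c hc]
  have hc0 : φ c = 0 := by linarith [h1 a ha, h1 b hb, h1 c hc]
  refine ⟨φ, h1, ha0, hb0, hc0, ?_⟩
  have := h2 p hp
  rw [he] at this
  simp only [map_add, map_smul, ha0, hb0, hc0, smul_zero, add_zero, smul_eq_mul] at this
  rcases (h1 x hx).eq_or_lt with h | h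
  · rw [← h] at this; simp at this
  · exact h

lemma exists_annihilator (W : Submodule ℝ V) (hW : Module.finrank ℝ W ≤ 2)
    (φ : Fin 3 → V →ₗ[ℝ] ℝ) :
    ∃ l : Fin 3 → ℝ, l ≠ 0 ∧ ∀ w ∈ W, ∑ i, l i * φ i w = 0 := by
  set Φ : V →ₗ[ℝ] (Fin 3 → ℝ) := LinearMap.pi φ
  have hlt : Module.finrank ℝ (W.map Φ) < Module.finrank ℝ (Fin 3 → ℝ) := by
    rw [Module.finrank_fin_fun]
    have := Submodule.finrank_map_le Φ W
    omega
  have hne : W.map Φ < ⊤ := by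
    rw [lt_top_iff_ne_top]
    intro h
    rw [h, finrank_top] at hlt
    exact lt_irrefl _ hlt
  obtain ⟨g, hg0, hg⟩ := Submodule.exists_le_ker_of_lt_top _ hne
  refine ⟨fun i => g (Pi.single i 1), ?_, ?_⟩
  · intro h
    apply hg0
    apply LinearMap.pi_ext'
    intro i
    ext
    simpa using congrFun h i
  · intro w hw
    have h1 : g (Φ w) = 0 := hg (Submodule.mem_map_of_mem hw)
    have h2 : Φ w = ∑ i, φ i w • (Pi.single i 1 : Fin 3 → ℝ) := by
      rw [pi_eq_sum_univ' (Φ w)]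
      rfl
    rw [h2, map_sum] at h1
    rw [← h1]
    refine Finset.sum_congr rfl fun i _ => ?_
    rw [map_smul, smul_eq_mul, mul_comm]

lemma no_line (Q : Set V) (hQK : Q ⊆ D.K) (hQadd : ∀ x ∈ Q, ∀ y ∈ Q, x + y ∈ Q)
    (hQsmul : ∀ t : ℝ, 0 < t → ∀ x ∈ Q, t • x ∈ Q)
    (X : Fin 3 → V) (hX : ∀ i, X i ∈ Q) (φ : Fin 3 → V →ₗ[ℝ] ℝ)
    (hφ : ∀ i, ∀ v ∈ D.K, 0 ≤ φ i v) (h0 : ∀ i j, i ≠ j → φ i (X j) = 0)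
    (hpos : ∀ i, 0 < φ i (X i)) (E : ℝ) (W : Submodule ℝ V) (hW : Module.finrank ℝ W ≤ 2)
    (h : ∀ p ∈ Q, (∃ E', D.N E' (X 0 + X 1 + X 2) p) → ∃ q ∈ W, D.N E p q) : False := by
  obtain ⟨l, hl0, hl⟩ := exists_annihilator W hW φ
  obtain ⟨i, hi⟩ : ∃ i, l i ≠ 0 := by
    by_contra hcon; push Not at hcon; exact hl0 (funext hcon)
  -- constant
  set B := ∑ j, |l j| * φ j (X j) with hB
  have hBn : 0 ≤ B := Finset.sum_nonneg fun j _ => mul_nonneg (abs_nonneg _) (hpos j).le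
  have hci : 0 < |l i| * φ i (X i) := mul_pos (abs_pos.2 hi) (hpos i)
  set M := 1 + (|E| * B + 1) / (|l i| * φ i (X i)) with hM
  have hM1 : 1 ≤ M := by rw [hM]; linarith [show 0 ≤ (|E| * B + 1) / (|l i| * φ i (X i)) by positivity]
  have hMb : |E| * B < M * (|l i| * φ i (X i)) := by
    rw [hM, add_mul, div_mul_cancel₀ _ hci.ne']; linarith
  set s : Fin 3 → ℝ := fun j => if j = i then M else 1 with hs
  have hs1 : ∀ j, 1 ≤ s j := by
    intro j; simp only [hs]; split_ifs <;> linarith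
  have hsM : ∀ j, s j ≤ M := by
    intro j; simp only [hs]; split_ifs <;> linarith
  set p := s 0 • X 0 + s 1 • X 1 + s 2 • X 2 with hp
  have hpQ : p ∈ Q := hQadd _ (hQadd _ (hQsmul _ (by linarith [hs1 0]) _ (hX 0)) _
    (hQsmul _ (by linarith [hs1 1]) _ (hX 1))) _ (hQsmul _ (by linarith [hs1 2]) _ (hX 2))
  have hφp : ∀ j, φ j p = s j * φ j (X j) := by
    intro j
    rw [hp]
    simp only [map_add, map_smul, smul_eq_mul]
    fin_cases j
    · simp [h0 0 1, h0 0 2]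
    · simp [h0 1 0, h0 1 2]
    · simp [h0 2 0, h0 2 1]
  obtain ⟨q, hqW, α, β, hα, hβ, hαβ, h4, h5⟩ := h p hpQ ⟨M, 1, M, one_pos, by linarith,
    by linarith, by
      have := D.K_add (D.K_add (D.K_smul (sub_nonneg.2 (hs1 0)) (hQK (hX 0)))
        (D.K_smul (sub_nonneg.2 (hs1 1)) (hQK (hX 1))))
        (D.K_smul (sub_nonneg.2 (hs1 2)) (hQK (hX 2)))
      convert this using 1; rw [hp]; module, by
      have := D.K_add (D.K_add (D.K_smul (sub_nonneg.2 (hsM 0)) (hQK (hX 0)))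
        (D.K_smul (sub_nonneg.2 (hsM 1)) (hQK (hX 1))))
        (D.K_smul (sub_nonneg.2 (hsM 2)) (hQK (hX 2)))
      convert this using 1; rw [hp]; module⟩
  have u1 : ∀ j, s j * φ j (X j) ≤ α * φ j q := by
    intro j
    have := hφ j _ h4
    rw [map_sub, map_smul, smul_eq_mul, hφp] at this; linarith
  have u2 : ∀ j, φ j q ≤ β * (s j * φ j (X j)) := by
    intro j
    have := hφ j _ h5
    rw [map_sub, map_smul, smul_eq_mul, hφp] at this; linarith
  have hqn : ∀ j, 0 ≤ φ j q := by
    intro j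
    have h1 := u1 j
    have h2 : 0 ≤ s j * φ j (X j) := mul_nonneg (by linarith [hs1 j]) (hpos j).le
    by_contra hneg
    push Not at hneg
    have := mul_neg_of_pos_of_neg hα hneg
    linarith
  have hsum := hl q hqW
  rw [← Finset.add_sum_erase _ _ (Finset.mem_univ i)] at hsum
  have k1 : |l i| * φ i q ≤ ∑ j ∈ Finset.univ.erase i, |l j| * φ j q := by
    have : l i * φ i q = - ∑ j ∈ Finset.univ.erase i, l j * φ j q := by linarith
    calc |l i| * φ i q = |l i * φ i q| := by rw [abs_mul, abs_of_nonneg (hqn i)]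
      _ = |∑ j ∈ Finset.univ.erase i, l j * φ j q| := by rw [this, abs_neg]
      _ ≤ ∑ j ∈ Finset.univ.erase i, |l j * φ j q| := Finset.abs_sum_le_sum_abs _ _
      _ = _ := Finset.sum_congr rfl fun j _ => by rw [abs_mul, abs_of_nonneg (hqn j)]
  have k2 : ∑ j ∈ Finset.univ.erase i, |l j| * φ j q ≤ β * B := by
    calc ∑ j ∈ Finset.univ.erase i, |l j| * φ j q
        ≤ ∑ j ∈ Finset.univ.erase i, β * (|l j| * φ j (X j)) := by
          refine Finset.sum_le_sum fun j hj => ?_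
          have h1 := u2 j
          have h2 : s j = 1 := by simp [hs, Finset.ne_of_mem_erase hj]
          rw [h2, one_mul] at h1
          calc |l j| * φ j q ≤ |l j| * (β * φ j (X j)) :=
                mul_le_mul_of_nonneg_left h1 (abs_nonneg _)
            _ = _ := by ring
      _ = β * ∑ j ∈ Finset.univ.erase i, (|l j| * φ j (X j)) := by rw [Finset.mul_sum]
      _ ≤ β * B := by
          refine mul_le_mul_of_nonneg_left ?_ hβ.le
          exact Finset.sum_le_sum_of_subset_of_nonneg (Finset.erase_subset _ _)
            fun j _ _ => mul_nonneg (abs_nonneg _) (hpos j).le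
  have k3 : M * (|l i| * φ i (X i)) ≤ α * (β * B) := by
    have h1 := u1 i
    have h2 : s i = M := by simp [hs]
    rw [h2] at h1
    calc M * (|l i| * φ i (X i)) = |l i| * (M * φ i (X i)) := by ring
      _ ≤ |l i| * (α * φ i q) := mul_le_mul_of_nonneg_left h1 (abs_nonneg _)
      _ = α * (|l i| * φ i q) := by ring
      _ ≤ α * (β * B) := mul_le_mul_of_nonneg_left (k1.trans k2) hα.le
  have k4 : α * (β * B) ≤ |E| * B := by
    rw [← mul_assoc]
    exact mul_le_mul_of_nonneg_right (hαβ.trans (le_abs_self E)) hBn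
  linarith

theorem no_bad (D : ConeData V) (Q P : Set V) (hQK : Q ⊆ D.K) (hQc : IsClosed Q)
    (hQadd : ∀ x ∈ Q, ∀ y ∈ Q, x + y ∈ Q)
    (hQsmul : ∀ t : ℝ, 0 < t → ∀ x ∈ Q, t • x ∈ Q)
    (hP : IsCompact P) (hPK : P ⊆ D.K0)
    (hF : ∀ x ∈ Q, x ∉ D.K0 → x ≠ 0 → ∃ E : ℝ, ∃ W : Submodule ℝ V, Module.finrank ℝ W ≤ 2 ∧
      ∀ p ∈ Q, (∃ E', D.N E' x p) → ∃ q ∈ W, D.N E p q) :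
    ∃ n : ℕ, ∀ Y t, ¬ Bad D Q P n Y t := by
  by_contra hcon
  push Not at hcon
  obtain ⟨Y, hY, p, hp, t, hpt, h3, h2, h1, h0⟩ := bad_limit D Q P hQK hQc hP hPK hcon
  rw [Fin.sum_univ_four] at hpt
  have hYK := fun i => hQK (hY i)
  obtain ⟨φ0, a0, b0, c0, -, e0⟩ := D.isolate (hYK 1) (hYK 2) (hYK 3) (hYK 0) hp hpt h0
  obtain ⟨φ1, a1, b1, c1, -, e1⟩ := D.isolate (t1 := t 1) (t2 := t 0) (t3 := t 2) (t4 := t 3)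
    (hYK 0) (hYK 2) (hYK 3) (hYK 1) hp (by rw [hpt]; module) h1
  obtain ⟨φ2, a2, b2, c2, -, e2⟩ := D.isolate (t1 := t 2) (t2 := t 0) (t3 := t 1) (t4 := t 3)
    (hYK 0) (hYK 1) (hYK 3) (hYK 2) hp (by rw [hpt]; module) h2
  obtain ⟨E, W, hW, h⟩ := hF (Y 0 + Y 1 + Y 2) (hQadd _ (hQadd _ (hY 0) _ (hY 1)) _ (hY 2)) h3 (by
    intro hz
    have := congrArg φ0 hz
    simp only [map_add, b0, c0, map_zero, add_zero] at this
    linarith)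
  refine no_line Q hQK hQadd hQsmul ![Y 0, Y 1, Y 2] ?_ ![φ0, φ1, φ2] ?_ ?_ ?_ E W hW ?_
  · intro i; fin_cases i <;> simp [hY]
  · intro i; fin_cases i <;> simpa
  · intro i j hij; fin_cases i <;> fin_cases j <;> simp_all
  · intro i; fin_cases i <;> simpa
  · simpa using h

theorem core (D : ConeData V) (Q P : Set V) (hQK : Q ⊆ D.K) (hQc : IsClosed Q)
    (hQadd : ∀ x ∈ Q, ∀ y ∈ Q, x + y ∈ Q)
    (hQsmul : ∀ t : ℝ, 0 < t → ∀ x ∈ Q, t • x ∈ Q)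
    (hP : IsCompact P) (hPK : P ⊆ D.K0)
    (hG : ∀ v ∈ Q, v ∈ D.K0 → ∃ g : V ≃ₗ[ℝ] V, (∀ x, g x ∈ D.K0 ↔ x ∈ D.K0) ∧
      (∀ x ∈ Q, g x ∈ Q) ∧ ∃ t : ℝ, 0 < t ∧ t • g v ∈ P)
    (hF : ∀ x ∈ Q, x ∉ D.K0 → x ≠ 0 → ∃ E : ℝ, ∃ W : Submodule ℝ V, Module.finrank ℝ W ≤ 2 ∧
      ∀ p ∈ Q, (∃ E', D.N E' x p) → ∃ q ∈ W, D.N E p q) :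
    ∃ E : ℝ, 1 < E ∧ ∀ a ∈ Q, ∀ b ∈ Q, ∀ c ∈ Q, ∀ y ∈ Q, ∀ z ∈ Q,
      a + b + c ∈ D.K0 → a + b ∉ D.K0 → a + c ∉ D.K0 → y ≠ 0 → z ≠ 0 →
      (∃ E', D.N E' a y) → (∃ E', D.N E' a z) → D.N E y z := by
  obtain ⟨n, hn⟩ := no_bad D Q P hQK hQc hQadd hQsmul hP hPK hF
  refine ⟨((n : ℝ) + 2) ^ 2, by nlinarith [Nat.cast_nonneg (α := ℝ) n], ?_⟩
  intro a ha b hb c hc y hy z hz habc hab hac hy0 hz0 ⟨E1, hN1⟩ ⟨E2, hN2⟩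
  by_contra hcon
  have hcon' : ¬ D.N ((n : ℝ) ^ 2) y z := fun h => hcon (h.mono (by nlinarith [Nat.cast_nonneg (α := ℝ) n]))
  have fy := D.K_pos (hQK hy) hy0
  have fz := D.K_pos (hQK hz) hz0
  have fb : 0 < D.f b := D.K_pos (hQK hb) (by rintro rfl; exact hac (by simpa using habc))
  have fc : 0 < D.f c := D.K_pos (hQK hc) (by rintro rfl; exact hab (by simpa using habc))
  obtain ⟨s, hs, hs1, hs2⟩ := midpoint fy fz (hQK hy) (hQK hz) (Nat.cast_nonneg n)
    (hN1.symm.trans hN2) hcon'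
  set m := s • y + z with hm
  have hmQ : m ∈ Q := hQadd _ (hQsmul _ hs _ hy) _ hz
  have fm : 0 < D.f m := by
    rw [hm, map_add, map_smul, smul_eq_mul]; positivity
  obtain ⟨α1, β1, p1, p2, -, p4, p5⟩ := hN1
  obtain ⟨α2, β2, q1, q2, -, q4, q5⟩ := hN2
  have hma : ∃ E3, D.N E3 a m := by
    refine ⟨_, α2, s * β1 + β2, q1, by positivity, le_rfl, ?_, ?_⟩
    · have := D.K_add q4 (D.K_smul (mul_pos q1 hs).le (hQK hy))
      convert this using 1; rw [hm]; module
    · have := D.K_add (D.K_smul hs.le p5) q5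
      convert this using 1; rw [hm]; module
  obtain ⟨E3, hN3⟩ := hma
  have hN1 : D.N (α1 * β1) a y := ⟨α1, β1, p1, p2, le_rfl, p4, p5⟩
  have hN2 : D.N (α2 * β2) a z := ⟨α2, β2, q1, q2, le_rfl, q4, q5⟩
  have ev1 := eventually_far (hQK ha) (hQK hb) (hQK hc) (hQK hy) habc hab hac hN3 hN1 hs1
    fb fc fm fy
  have ev2 := eventually_far (hQK ha) (hQK hb) (hQK hc) (hQK hz) habc hab hac hN3 hN2 hs2
    fb fc fm fz
  obtain ⟨k, hk1, hk2⟩ := (ev1.and ev2).exists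
  set ε : ℝ := 1 / ((k : ℝ) + 1) with hε
  have hεpos : 0 < ε := by positivity
  set p := m + ε • (b + c) with hp
  have hpQ : p ∈ Q := hQadd _ hmQ _ (hQsmul _ hεpos _ (hQadd _ hb _ hc))
  have hpK : p ∈ D.K0 := by
    obtain ⟨α, β, r1, r2, -, r4, r5⟩ := hN3
    refine D.K0_of_le (c := α + 1 / ε) (by positivity) habc ?_
    have e : (1 / ε) • ε • (b + c) = b + c := by
      rw [smul_smul, one_div_mul_cancel hεpos.ne', one_smul]
    have := D.K_add (D.K_add r4 (D.K_smul (show 0 ≤ 1 / ε by positivity) (hQK hmQ)))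
      (D.K_smul (mul_pos r1 hεpos).le (hQK (hQadd _ hb _ hc)))
    convert this using 1
    have : (α + 1 / ε) • p = α • m + (1 / ε) • m + (α * ε) • (b + c) + (1 / ε) • ε • (b + c) := by
      rw [hp]; module
    rw [this, e]; abel
  obtain ⟨g, hg0, hgQ, t, ht, htP⟩ := hG p hpQ hpK
  have hgcont : Continuous g := LinearMap.continuous_of_finiteDimensional g.toLinearMap
  have hgcont' : Continuous g.symm := LinearMap.continuous_of_finiteDimensional g.symm.toLinearMap
  have hgK' : ∀ x, g x ∈ D.K → x ∈ D.K := by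
    intro x hx
    have := map_mem_closure hgcont' hx (t := D.K0) (fun v hv => by
      rw [← hg0, g.apply_symm_apply]; exact hv)
    rwa [g.symm_apply_apply] at this
  have hgN : ∀ E x y, D.N E (g x) (g y) → D.N E x y := by
    rintro E x y ⟨α, β, h1, h2, h3, h4, h5⟩
    refine ⟨α, β, h1, h2, h3, hgK' _ (by simpa using h4), hgK' _ (by simpa using h5)⟩
  have fg : ∀ x ∈ Q, 0 < D.f x → 0 < D.f (g x) := by
    intro x hx hfx
    apply D.K_pos (hQK (hgQ x hx))
    intro h0
    have : x = 0 := by simpa using h0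
    rw [this] at hfx; simp at hfx
  -- normalised points
  set ny := (D.f (g y))⁻¹ with hny
  set nz := (D.f (g z))⁻¹ with hnz
  set nb := (D.f (g b))⁻¹ with hnb
  set nc := (D.f (g c))⁻¹ with hnc
  have fgy := fg y hy fy
  have fgz := fg z hz fz
  have fgb := fg b hb fb
  have fgc := fg c hc fc
  have nyp : 0 < ny := inv_pos.2 fgy
  have nzp : 0 < nz := inv_pos.2 fgz
  have nbp : 0 < nb := inv_pos.2 fgb
  have ncp : 0 < nc := inv_pos.2 fgc
  have key : ∑ i, (![t * s / ny, t / nz, t * ε / nb, t * ε / nc] : Fin 4 → ℝ) i •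
      (![ny • g y, nz • g z, nb • g b, nc • g c] : Fin 4 → V) i = t • g p := by
    rw [Fin.sum_univ_four]
    simp only [Matrix.cons_val]
    rw [hp, hm]
    simp only [smul_smul, map_add, map_smul]
    rw [div_mul_cancel₀ _ nyp.ne', div_mul_cancel₀ _ nzp.ne', div_mul_cancel₀ _ nbp.ne',
      div_mul_cancel₀ _ ncp.ne']
    module
  refine hn ![ny • g y, nz • g z, nb • g b, nc • g c]
    ![t * s / ny, t / nz, t * ε / nb, t * ε / nc] ⟨?_, ?_, ?_, ?_, ?_, ?_, ?_⟩
  · intro i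
    fin_cases i
    · exact ⟨hQsmul _ nyp _ (hgQ _ hy), by simp [hny, fgy.ne']⟩
    · exact ⟨hQsmul _ nzp _ (hgQ _ hz), by simp [hnz, fgz.ne']⟩
    · exact ⟨hQsmul _ nbp _ (hgQ _ hb), by simp [hnb, fgb.ne']⟩
    · exact ⟨hQsmul _ ncp _ (hgQ _ hc), by simp [hnc, fgc.ne']⟩
  · intro i
    fin_cases i <;> simp <;> positivity
  · rw [key]; exact htP
  · simp only [Matrix.cons_val]
    intro hh
    rw [← map_smul, ← map_smul, ← map_smul, ← map_add, ← map_add, hg0] at hh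
    apply hab
    refine D.K0_of_le (c := ny * β1 + nz * β2 + nb) (by positivity) hh ?_
    have := D.K_add (D.K_add (D.K_smul nyp.le p5) (D.K_smul nzp.le q5))
      (D.K_add (D.K_smul (show 0 ≤ ny * β1 + nz * β2 by positivity) (hQK hb))
        (D.K_smul nbp.le (hQK ha)))
    convert this using 1; module
  · simp only [Matrix.cons_val]
    intro hh
    rw [← map_smul, ← map_smul, ← map_smul, ← map_add, ← map_add, hg0] at hh
    apply hac
    refine D.K0_of_le (c := ny * β1 + nz * β2 + nc) (by positivity) hh ?_
    have := D.K_add (D.K_add (D.K_smul nyp.le p5) (D.K_smul nzp.le q5))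
      (D.K_add (D.K_smul (show 0 ≤ ny * β1 + nz * β2 by positivity) (hQK hc))
        (D.K_smul ncp.le (hQK ha)))
    convert this using 1; module
  · rw [key]
    simp only [Matrix.cons_val]
    intro hh
    rw [← map_smul, ← map_smul, ← map_smul, ← map_smul, ← map_add, ← map_add] at hh
    have hh := (hgN _ _ _ hh).smul_left (inv_pos.2 ht)
    rw [smul_smul, inv_mul_cancel₀ ht.ne', one_smul] at hh
    refine hk1 ny nb nc nyp.le nbp.le ncp.le ?_ hh
    intro h0
    have := congrArg D.f h0
    simp only [map_add, map_smul, smul_eq_mul, map_zero] at this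
    have : 0 < ny * D.f y + nb * D.f b + nc * D.f c := by positivity
    linarith
  · rw [key]
    simp only [Matrix.cons_val]
    intro hh
    rw [← map_smul, ← map_smul, ← map_smul, ← map_smul, ← map_add, ← map_add] at hh
    have hh := (hgN _ _ _ hh).smul_left (inv_pos.2 ht)
    rw [smul_smul, inv_mul_cancel₀ ht.ne', one_smul] at hh
    refine hk2 nz nb nc nzp.le nbp.le ncp.le ?_ hh
    intro h0
    have := congrArg D.f h0
    simp only [map_add, map_smul, smul_eq_mul, map_zero] at this
    have : 0 < nz * D.f z + nb * D.f b + nc * D.f c := by positivity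
    linarith

end ConeData

section projective


lemma chartMap_mk (f : (Fin d → ℝ) →ₗ[ℝ] ℝ) (v : (Fin d → ℝ)) (h : v ≠ 0) :
    chartMap f (Projectivization.mk ℝ v h) = (f v)⁻¹ • v := by
  obtain ⟨a, ha⟩ := Projectivization.exists_smul_eq_mk_rep ℝ v h
  unfold chartMap
  rw [← ha, Units.smul_def, map_smul, smul_smul, smul_eq_mul, mul_inv, mul_comm, ← mul_assoc,
    mul_inv_cancel₀ a.ne_zero, one_mul]

lemma frep_mk (f : (Fin d → ℝ) →ₗ[ℝ] ℝ) (v : (Fin d → ℝ)) (h : v ≠ 0) :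
    f (Projectivization.mk ℝ v h).rep ≠ 0 ↔ f v ≠ 0 := by
  obtain ⟨a, ha⟩ := Projectivization.exists_smul_eq_mk_rep ℝ v h
  rw [← ha, Units.smul_def, map_smul, smul_eq_mul]
  simp

lemma mk_smul (v : (Fin d → ℝ)) (h : v ≠ 0) (t : ℝ) (_ : t ≠ 0) (h' : t • v ≠ 0) :
    Projectivization.mk ℝ (t • v) h' = Projectivization.mk ℝ v h := by
  rw [Projectivization.mk_eq_mk_iff']
  exact ⟨t, rfl⟩

lemma chartMap_ne (f : (Fin d → ℝ) →ₗ[ℝ] ℝ) (x : PSpace d) (h : f x.rep ≠ 0) : chartMap f x ≠ 0 :=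
  smul_ne_zero (inv_ne_zero h) x.rep_nonzero

lemma f_chartMap (f : (Fin d → ℝ) →ₗ[ℝ] ℝ) (x : PSpace d) (h : f x.rep ≠ 0) : f (chartMap f x) = 1 := by
  unfold chartMap; rw [map_smul, smul_eq_mul, inv_mul_cancel₀ h]

lemma mk_chartMap (f : (Fin d → ℝ) →ₗ[ℝ] ℝ) (x : PSpace d) (h : f x.rep ≠ 0) (h' : chartMap f x ≠ 0) :
    Projectivization.mk ℝ (chartMap f x) h' = x := by
  have h1 : Projectivization.mk ℝ (chartMap f x) h' = Projectivization.mk ℝ x.rep x.rep_nonzero := by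
    rw [Projectivization.mk_eq_mk_iff']
    exact ⟨(f x.rep)⁻¹, rfl⟩
  rw [h1, Projectivization.mk_rep]

lemma continuous_mk :
    Continuous (fun v : {v : (Fin d → ℝ) // v ≠ 0} => (Projectivization.mk ℝ v.1 v.2 : PSpace d)) :=
  continuous_quotient_mk'

lemma isQuotientMap_mk :
    Topology.IsQuotientMap
      (fun v : {v : (Fin d → ℝ) // v ≠ 0} => (Projectivization.mk ℝ v.1 v.2 : PSpace d)) :=
  isQuotientMap_quotient_mk'

lemma fcont' (f : (Fin d → ℝ) →ₗ[ℝ] ℝ) : Continuous f := LinearMap.continuous_of_finiteDimensional _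

lemma isOpen_chart (f : (Fin d → ℝ) →ₗ[ℝ] ℝ) : IsOpen {x : PSpace d | f x.rep ≠ 0} := by
  rw [← isQuotientMap_mk.isOpen_preimage]
  have : (fun v : {v : (Fin d → ℝ) // v ≠ 0} => (Projectivization.mk ℝ v.1 v.2 : PSpace d)) ⁻¹'
      {x : PSpace d | f x.rep ≠ 0} = {v | f v.1 ≠ 0} := by
    ext v; exact frep_mk f v.1 v.2
  rw [this]
  exact isOpen_ne_fun ((fcont' f).comp continuous_subtype_val) continuous_const

lemma continuousOn_chartMap (f : (Fin d → ℝ) →ₗ[ℝ] ℝ) :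
    ContinuousOn (chartMap f) {x : PSpace d | f x.rep ≠ 0} := by
  rw [isQuotientMap_mk.continuousOn_isOpen_iff (isOpen_chart f)]
  have : (chartMap f ∘ fun v : {v : (Fin d → ℝ) // v ≠ 0} => (Projectivization.mk ℝ v.1 v.2 : PSpace d))
      = fun v => (f v.1)⁻¹ • v.1 := by
    ext1 v; exact chartMap_mk f v.1 v.2
  rw [this]
  intro v hv
  have hv' : f v.1 ≠ 0 := (frep_mk f v.1 v.2).1 hv
  apply ContinuousAt.continuousWithinAt
  have c1 : ContinuousAt (fun v : {v : (Fin d → ℝ) // v ≠ 0} => f v.1) v :=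
    ((fcont' f).comp continuous_subtype_val).continuousAt
  exact (c1.inv₀ hv').smul continuous_subtype_val.continuousAt

/-- The vectors over `A`. -/
def lift (A : Set (PSpace d)) : Set (Fin d → ℝ) := {v | ∃ h : v ≠ 0, Projectivization.mk ℝ v h ∈ A}

/-- The positive cone over `A`. -/
def cone (f : (Fin d → ℝ) →ₗ[ℝ] ℝ) (A : Set (PSpace d)) : Set (Fin d → ℝ) := {v | 0 < f v ∧ v ∈ lift A}

lemma isOpen_lift {A : Set (PSpace d)} (hA : IsOpen A) : IsOpen (lift A) := by
  have h1 := hA.preimage continuous_mk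
  have h2 : IsOpen {v : (Fin d → ℝ) | v ≠ 0} := isOpen_ne
  have h3 := h2.isOpenMap_subtype_val _ h1
  convert h3 using 1
  ext v
  constructor
  · rintro ⟨h, hm⟩; exact ⟨⟨v, h⟩, hm, rfl⟩
  · rintro ⟨⟨w, h⟩, hm, rfl⟩; exact ⟨h, hm⟩

lemma isOpen_cone (f : (Fin d → ℝ) →ₗ[ℝ] ℝ) {A : Set (PSpace d)} (hA : IsOpen A) : IsOpen (cone f A) :=
  (isOpen_lt continuous_const (fcont' f)).inter (isOpen_lift hA)

lemma mk_mem_closure {A : Set (PSpace d)} {v : (Fin d → ℝ)} (h : v ≠ 0) (hv : v ∈ closure (lift A)) :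
    Projectivization.mk ℝ v h ∈ closure A := by
  have h1 : (⟨v, h⟩ : {v : (Fin d → ℝ) // v ≠ 0}) ∈ closure
      ((fun v : {v : (Fin d → ℝ) // v ≠ 0} => (Projectivization.mk ℝ v.1 v.2 : PSpace d)) ⁻¹' A) := by
    rw [closure_subtype]
    refine closure_mono ?_ hv
    rintro w ⟨hw, hm⟩
    exact ⟨⟨w, hw⟩, hm, rfl⟩
  exact map_mem_closure continuous_mk h1 (fun w hw => hw)

lemma cone_iff (f : (Fin d → ℝ) →ₗ[ℝ] ℝ) {A : Set (PSpace d)} (hA : ∀ x ∈ A, f x.rep ≠ 0) (v : (Fin d → ℝ)) :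
    v ∈ cone f A ↔ 0 < f v ∧ (f v)⁻¹ • v ∈ chartMap f '' A := by
  constructor
  · rintro ⟨h1, h2, h3⟩
    exact ⟨h1, _, h3, chartMap_mk f v h2⟩
  · rintro ⟨h1, x, hx, h2⟩
    have h0 : v ≠ 0 := by rintro rfl; simp at h1
    refine ⟨h1, h0, ?_⟩
    have h3 := mk_chartMap f x (hA x hx) (chartMap_ne f x (hA x hx))
    have h4 : Projectivization.mk ℝ (chartMap f x) (chartMap_ne f x (hA x hx))
        = Projectivization.mk ℝ v h0 := by
      rw [Projectivization.mk_eq_mk_iff']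
      exact ⟨_, h2.symm⟩
    rw [← h4, h3]; exact hx

lemma lift_smul {A : Set (PSpace d)} {t : ℝ} (ht : t ≠ 0) {v : (Fin d → ℝ)} (hv : v ∈ lift A) :
    t • v ∈ lift A := by
  obtain ⟨h, hm⟩ := hv
  exact ⟨smul_ne_zero ht h, by rwa [mk_smul v h t ht]⟩

lemma cone_smul (f : (Fin d → ℝ) →ₗ[ℝ] ℝ) {A : Set (PSpace d)} {t : ℝ} (ht : 0 < t) {v : (Fin d → ℝ)}
    (hv : v ∈ cone f A) : t • v ∈ cone f A :=
  ⟨by rw [map_smul, smul_eq_mul]; exact mul_pos ht hv.1, lift_smul ht.ne' hv.2⟩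

lemma cone_add (f : (Fin d → ℝ) →ₗ[ℝ] ℝ) {A : Set (PSpace d)} (hA : ∀ x ∈ A, f x.rep ≠ 0)
    (hc : Convex ℝ (chartMap f '' A)) {v w : (Fin d → ℝ)} (hv : v ∈ cone f A) (hw : w ∈ cone f A) :
    v + w ∈ cone f A := by
  rw [cone_iff f hA] at hv hw ⊢
  have h0 : 0 < f (v + w) := by rw [map_add]; exact add_pos hv.1 hw.1
  refine ⟨h0, ?_⟩
  have := hc hv.2 hw.2 (a := f v / f (v + w)) (b := f w / f (v + w))
    (div_pos hv.1 h0).le (div_pos hw.1 h0).le (by rw [← add_div, ← map_add, div_self h0.ne'])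
  convert this using 1
  have e : ∀ u : (Fin d → ℝ), 0 < f u → (f u / f (v + w)) • (f u)⁻¹ • u = (f (v + w))⁻¹ • u := by
    intro u hu
    rw [smul_smul]; congr 1; field_simp
  rw [e v hv.1, e w hw.1, smul_add]

lemma cone_closure_iff (f : (Fin d → ℝ) →ₗ[ℝ] ℝ) {A : Set (PSpace d)} (hA : ∀ x ∈ closure A, f x.rep ≠ 0)
    {v : (Fin d → ℝ)} (h0 : v ≠ 0) (hf : 0 < f v) :
    Projectivization.mk ℝ v h0 ∈ closure A ↔ v ∈ closure (cone f A) := by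
  constructor
  · intro h
    have c : ContinuousAt (chartMap f) (Projectivization.mk ℝ v h0) :=
      (continuousOn_chartMap f).continuousAt
        ((isOpen_chart f).mem_nhds ((frep_mk f v h0).2 hf.ne'))
    have h1 := mem_closure_image c h
    rw [chartMap_mk] at h1
    have h2 : (f v)⁻¹ • v ∈ closure (cone f A) := by
      refine closure_mono ?_ h1
      rintro _ ⟨x, hx, rfl⟩
      have hx' := hA x (subset_closure hx)
      exact ⟨by rw [f_chartMap f x hx']; norm_num, chartMap_ne f x hx',
        by rwa [mk_chartMap f x hx']⟩
    have h3 := map_mem_closure (continuous_const_smul (f v)) h2 (fun a ha => cone_smul f hf ha)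
    rwa [smul_smul, mul_inv_cancel₀ hf.ne', one_smul] at h3
  · intro h
    exact mk_mem_closure h0 (closure_mono (fun w hw => hw.2) h)

end projective

namespace ConeData
variable {V : Type*} [NormedAddCommGroup V] [NormedSpace ℝ V] [FiniteDimensional ℝ V]
variable {D : ConeData V}

lemma N.mem_right {E : ℝ} {x y : V} (h : D.N E x y) (hx : x ∈ D.K) : y ∈ D.K := by
  obtain ⟨α, β, h1, h2, h3, h4, h5⟩ := h
  have := D.K_smul (inv_pos.2 h1).le (D.K_add h4 hx)
  rwa [sub_add_cancel, smul_smul, inv_mul_cancel₀ h1.ne', one_smul] at this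

lemma N_of_dom {x y : V} {a b : ℝ} (ha : 0 < a) (hb : 0 < b) (h1 : a • y - x ∈ D.K)
    (h2 : b • x - y ∈ D.K) : ∃ E, D.N E x y := ⟨_, a, b, ha, hb, le_rfl, h1, h2⟩

lemma side {u w : V} {E0 : ℝ} (hu : u ∈ D.K) (hw : w ∈ D.K) (h : D.N E0 u w)
    (hb : BddAbove {t : ℝ | ∃ E, D.N E u (u + t • (w - u))}) :
    1 < sSup {t : ℝ | ∃ E, D.N E u (u + t • (w - u))} ∧
    (sSup {t : ℝ | ∃ E, D.N E u (u + t • (w - u))} /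
      (sSup {t : ℝ | ∃ E, D.N E u (u + t • (w - u))} - 1)) • w - u ∈ D.K ∧
    ∀ α : ℝ, α • w - u ∈ D.K → sSup {t : ℝ | ∃ E, D.N E u (u + t • (w - u))} /
      (sSup {t : ℝ | ∃ E, D.N E u (u + t • (w - u))} - 1) ≤ α := by
  obtain ⟨α1, β1, p1, p2, -, p4, p5⟩ := h
  set T := {t : ℝ | ∃ E, D.N E u (u + t • (w - u))} with hT
  have h1 : 1 + 1 / (2 * α1) ∈ T := by
    refine N_of_dom (a := 2 * α1) (b := (1 + 1 / (2 * α1)) * β1) (by positivity)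
      (by positivity) ?_ ?_
    · have := D.K_add (D.K_smul (show (0:ℝ) ≤ 2 by norm_num) p4) hw
      convert this using 1
      have e : (2 * α1) * (1 / (2 * α1)) = 1 := by field_simp
      have : (2 * α1) • (u + (1 + 1 / (2 * α1)) • (w - u)) =
        (2 * α1) • w + ((2 * α1) * (1 / (2 * α1))) • (w - u) := by module
      rw [this, e]; module
    · have := D.K_add (D.K_smul (show (0:ℝ) ≤ 1 + 1 / (2 * α1) by positivity) p5)
        (D.K_smul (show (0:ℝ) ≤ 1 / (2 * α1) by positivity) hu)
      convert this using 1
      module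
  have htp : 1 < sSup T := lt_of_lt_of_le (by
    have : 0 < 1 / (2 * α1) := by positivity
    linarith) (le_csSup hb h1)
  set tp := sSup T with htpdef
  have htp' : 0 < tp - 1 := by linarith
  refine ⟨htp, ?_, ?_⟩
  · have hc : IsClosed {t : ℝ | u + t • (w - u) ∈ D.K} := D.K_closed.preimage (by fun_prop)
    have hsub : T ⊆ {t : ℝ | u + t • (w - u) ∈ D.K} := by
      rintro t ⟨E, hE⟩; exact hE.mem_right hu
    have hmem : u + tp • (w - u) ∈ D.K :=
      closure_minimal hsub hc (csSup_mem_closure ⟨_, h1⟩ hb)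
    have := D.K_smul (inv_pos.2 htp').le hmem
    convert this using 1
    have e : (tp - 1)⁻¹ • (u + tp • (w - u)) =
      (tp * (tp - 1)⁻¹) • w - ((tp - 1)⁻¹ * (tp - 1)) • u := by module
    rw [e, inv_mul_cancel₀ htp'.ne', one_smul]; rfl
  · intro α hα
    have hα1 : 1 < α := by
      by_contra hle
      push Not at hle
      have hwu : w - u ∈ D.K := by
        have := D.K_add hα (D.K_smul (sub_nonneg.2 hle) hw)
        convert this using 1; module
      have : tp + 1 ∈ T := by
        have ht : 0 ≤ tp + 1 := by linarith
        refine N_of_dom (a := 1) (b := (tp + 1) * β1 + 1) one_pos (by positivity) ?_ ?_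
        · have := D.K_smul ht hwu
          convert this using 1; module
        · have := D.K_add (D.K_smul ht p5) (D.K_smul ht hu)
          convert this using 1; module
      have := le_csSup hb this
      linarith
    have hle : α / (α - 1) ≤ tp := by
      refine le_of_forall_lt fun t ht => ?_
      by_cases ht1 : t ≤ 1
      · linarith
      push Not at ht1
      -- choose t' between t and t0
      obtain ⟨r, hr1, hr2⟩ := exists_between ht
      refine lt_of_lt_of_le hr1 (le_csSup hb ?_)
      have hr : 1 < r := ht1.trans hr1
      rw [lt_div_iff₀ (by linarith)] at hr2
      have hκ : 0 < α - r * (α - 1) := by linarith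
      set κ := α - r * (α - 1) with hκd
      refine N_of_dom (a := α1 / κ) (b := r * β1) (by positivity) (by positivity) ?_ ?_
      · have := D.K_add (D.K_smul (show 0 ≤ α1 / κ * (r - 1) by
          have : 0 < r - 1 := by linarith
          positivity) hα) p4
        convert this using 1
        have e : α1 = α1 / κ * κ := by field_simp
        have e2 : (α1 / κ * (r - 1)) • (α • w - u) + (α1 • w - u) =
          (α1 / κ * (r - 1)) • (α • w - u) + ((α1 / κ * κ) • w - u) := by rw [← e]
        rw [e2, hκd]
        module
      · have := D.K_add (D.K_smul (show 0 ≤ r by linarith) p5)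
          (D.K_smul (show 0 ≤ r - 1 by linarith) hu)
        convert this using 1; module
    rw [div_le_iff₀ (by linarith)] at hle
    rw [div_le_iff₀ (by linarith)]
    linarith

lemma hilb {u w : V} {E0 : ℝ} (hu : u ∈ D.K) (hw : w ∈ D.K) (h : D.N E0 u w)
    (T : Set ℝ) (hT : ∀ t, t ∈ T ↔ ∃ E, D.N E u (u + t • (w - u)))
    (hb : BddAbove T) (hb' : BddBelow T) :
    D.N (Real.exp (2 * ((1 / 2) * Real.log ((sSup T * (1 - sInf T)) /
      ((-(sInf T)) * (sSup T - 1)))))) u w ∧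
    ∀ E, D.N E u w → (1 / 2) * Real.log ((sSup T * (1 - sInf T)) /
      ((-(sInf T)) * (sSup T - 1))) ≤ (1 / 2) * Real.log E := by
  have hTe : T = {t : ℝ | ∃ E, D.N E u (u + t • (w - u))} := Set.ext hT
  obtain ⟨h1, h2, h3⟩ := side hu hw h (by rwa [← hTe])
  rw [← hTe] at h1 h2 h3
  have hTe' : {t : ℝ | ∃ E, D.N E w (w + t • (u - w))} = (fun t => 1 - t) '' T := by
    ext t
    constructor
    · rintro ⟨E, hE⟩
      refine ⟨1 - t, (hT _).2 ⟨_, h.trans (?_ : D.N E w _)⟩, by ring⟩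
      convert hE using 1; module
    · rintro ⟨s, hs, rfl⟩
      obtain ⟨E, hE⟩ := (hT _).1 hs
      refine ⟨_, h.symm.trans (?_ : D.N E u _)⟩
      convert hE using 1; module
  have hne : T.Nonempty := by
    refine ⟨0, (hT 0).2 ⟨1, ?_⟩⟩
    simpa using N_refl
  have hglb : IsLUB ((fun t => 1 - t) '' T) (1 - sInf T) := by
    have hg := isGLB_csInf hne hb'
    constructor
    · rintro _ ⟨t, ht, rfl⟩
      have := hg.1 ht
      simp only; linarith
    · intro c hc
      have : 1 - c ≤ sInf T := hg.2 (fun t ht => by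
        have := hc ⟨t, ht, rfl⟩
        simp only at this; linarith)
      linarith
  obtain ⟨k1, k2, k3⟩ := side hw hu h.symm (by rw [hTe']; exact ⟨_, hglb.1⟩)
  rw [hTe', hglb.csSup_eq (hne.image _)] at k1 k2 k3
  set tp := sSup T
  set tm := sInf T
  have e : (tp * (1 - tm)) / ((-tm) * (tp - 1)) = (tp / (tp - 1)) * ((1 - tm) / (1 - tm - 1)) := by
    have a1 : tp - 1 ≠ 0 := by linarith
    have a2 : -tm ≠ 0 := by intro h; linarith
    rw [show 1 - tm - 1 = -tm by ring, div_mul_div_comm, mul_comm (tp - 1)]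
  have q1 : 0 < tp / (tp - 1) := div_pos (by linarith) (by linarith)
  have q2 : 0 < (1 - tm) / (1 - tm - 1) := div_pos (by linarith) (by linarith)
  rw [e]
  constructor
  · rw [← mul_assoc, mul_one_div_cancel two_ne_zero, one_mul, Real.exp_log (mul_pos q1 q2)]
    exact ⟨_, _, q1, q2, le_rfl, h2, k2⟩
  · rintro E ⟨α, β, r1, r2, r3, r4, r5⟩
    have : tp / (tp - 1) * ((1 - tm) / (1 - tm - 1)) ≤ E :=
      (mul_le_mul (h3 _ r4) (k3 _ r5) q2.le r1.le).trans r3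
    have := Real.log_le_log (mul_pos q1 q2) this
    linarith
end ConeData

lemma chartOf_spec {A : Set (PSpace d)} (h : IsProperlyConvex A) :
    (∀ x ∈ closure A, chartOf A x.rep ≠ 0) ∧
    Convex ℝ (chartMap (chartOf A) '' A) ∧ Bornology.IsBounded (chartMap (chartOf A) '' A) := by
  have : chartOf A = h.choose := by unfold chartOf; rw [dif_pos h]
  rw [this]
  exact h.choose_spec

lemma exists_bound {A : Set (PSpace d)} (h : IsProperlyConvex A) :
    ∃ M : ℝ, ∀ v ∈ cone (chartOf A) A, ‖v‖ ≤ M * chartOf A v := by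
  obtain ⟨M, hM⟩ := (chartOf_spec h).2.2.exists_norm_le
  refine ⟨M, fun v hv => ?_⟩
  have hv' := (cone_iff _ (fun x hx => (chartOf_spec h).1 x (subset_closure hx)) v).1 hv
  have := hM _ hv'.2
  rw [norm_smul, norm_inv, Real.norm_of_nonneg hv'.1.le, inv_mul_le_iff₀ hv'.1] at this
  linarith

/-- The cone data of a properly convex domain. -/
def coneData (Ω : Set (PSpace d)) (h : IsPCDomain Ω) : ConeData (Fin d → ℝ) where
  K0 := cone (chartOf Ω) Ω
  f := chartOf Ω
  M := (exists_bound h.2.2).choose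
  isOpen := isOpen_cone _ h.1
  nonempty := by
    obtain ⟨x, hx⟩ := h.2.1
    have hx' := (chartOf_spec h.2.2).1 x (subset_closure hx)
    exact ⟨chartMap (chartOf Ω) x, by rw [f_chartMap _ x hx']; exact one_pos,
      chartMap_ne _ x hx', by rwa [mk_chartMap _ x hx']⟩
  smul_mem := fun t ht v hv => cone_smul _ ht hv
  add_mem := fun v hv w hw => cone_add _ (fun x hx => (chartOf_spec h.2.2).1 x (subset_closure hx))
    (chartOf_spec h.2.2).2.1 hv hw
  pos := fun v hv => hv.1
  bound := (exists_bound h.2.2).choose_spec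

section faces
variable {Ω : Set (PSpace d)} (h : IsPCDomain Ω)
include h

lemma f_ne {x : PSpace d} (hx : x ∈ closure Ω) : chartOf Ω x.rep ≠ 0 := (chartOf_spec h.2.2).1 x hx

lemma f_cmap {x : PSpace d} (hx : x ∈ closure Ω) : chartOf Ω (cmap Ω x) = 1 :=
  f_chartMap _ x (f_ne h hx)

lemma cmap_ne {x : PSpace d} (hx : x ∈ closure Ω) : cmap Ω x ≠ 0 :=
  chartMap_ne _ x (f_ne h hx)

lemma mk_cmap {x : PSpace d} (hx : x ∈ closure Ω) :
    Projectivization.mk ℝ (cmap Ω x) (cmap_ne h hx) = x :=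
  mk_chartMap _ x (f_ne h hx) _

lemma cmap_mem_K {x : PSpace d} (hx : x ∈ closure Ω) : cmap Ω x ∈ (coneData Ω h).K := by
  refine (cone_closure_iff (chartOf Ω) (chartOf_spec h.2.2).1 (cmap_ne h hx) ?_).1 ?_
  · rw [f_cmap h hx]; exact one_pos
  · rwa [mk_cmap h hx]

lemma mk_mem_of_K {v : Fin d → ℝ} (hv : v ∈ (coneData Ω h).K) (h0 : v ≠ 0) :
    Projectivization.mk ℝ v h0 ∈ closure Ω :=
  (cone_closure_iff (chartOf Ω) (chartOf_spec h.2.2).1 h0 ((coneData Ω h).K_pos hv h0)).2 hv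

lemma cmap_mk {v : Fin d → ℝ} (h0 : v ≠ 0) :
    cmap Ω (Projectivization.mk ℝ v h0) = (chartOf Ω v)⁻¹ • v := chartMap_mk _ v h0

lemma mem_face_iff {x y : PSpace d} (hx : x ∈ closure Ω) :
    y ∈ face Ω x ↔ y ∈ closure Ω ∧ ∃ E, (coneData Ω h).N E (cmap Ω x) (cmap Ω y) := by
  constructor
  · rintro (rfl | ⟨hy, a, ha, b, hb, ⟨-, hx2⟩, ⟨-, hy2⟩⟩)
    · exact ⟨hx, 1, ConeData.N_refl⟩
    · refine ⟨hy, ?_⟩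
      have ha' := cmap_mem_K h ha
      have hb' := cmap_mem_K h hb
      obtain ⟨s, t, hs, ht, -, e⟩ := hx2
      obtain ⟨s', t', hs', ht', -, e'⟩ := hy2
      have key : ∀ s t s' t' : ℝ, 0 < s → 0 < t → 0 < s' → 0 < t' →
          (s / s' + t / t') • (s' • cmap Ω a + t' • cmap Ω b) - (s • cmap Ω a + t • cmap Ω b)
            ∈ (coneData Ω h).K := by
        intro s t s' t' hs ht hs' ht'
        have := (coneData Ω h).K_add
          ((coneData Ω h).K_smul (show 0 ≤ (s / s' + t / t') * s' - s by
            rw [add_mul, div_mul_cancel₀ _ hs'.ne']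
            have : 0 < t / t' * s' := by positivity
            linarith) ha')
          ((coneData Ω h).K_smul (show 0 ≤ (s / s' + t / t') * t' - t by
            rw [add_mul, div_mul_cancel₀ _ ht'.ne']
            have : 0 < s / s' * t' := by positivity
            linarith) hb')
        convert this using 1; module
      rw [← e, ← e']
      exact ConeData.N_of_dom (by positivity) (by positivity) (key s t s' t' hs ht hs' ht')
        (key s' t' s t hs' ht' hs ht)
  · rintro ⟨hy, E, α, β, h1, h2, -, h4, h5⟩
    by_cases hxy : y = x
    · exact Or.inl hxy
    right
    have hxK := cmap_mem_K h hx
    have hyK := cmap_mem_K h hy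
    -- enlarge
    have h4' := (coneData Ω h).K_add h4 ((coneData Ω h).K_smul (show (0:ℝ) ≤ 2 by norm_num) hyK)
    have h5' := (coneData Ω h).K_add h5 ((coneData Ω h).K_smul (show (0:ℝ) ≤ 2 by norm_num) hxK)
    have e4 : α • cmap Ω y - cmap Ω x + (2:ℝ) • cmap Ω y = (α + 2) • cmap Ω y - cmap Ω x := by module
    have e5 : β • cmap Ω x - cmap Ω y + (2:ℝ) • cmap Ω x = (β + 2) • cmap Ω x - cmap Ω y := by module
    rw [e4] at h4'
    rw [e5] at h5'
    have fx := f_cmap h hx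
    have fy := f_cmap h hy
    set u := (α + 2) • cmap Ω y - cmap Ω x with hu
    set w := (β + 2) • cmap Ω x - cmap Ω y with hw
    have fu : chartOf Ω u = α + 1 := by
      rw [hu, map_sub, map_smul, fx, fy, smul_eq_mul]; ring
    have fw : chartOf Ω w = β + 1 := by
      rw [hw, map_sub, map_smul, fx, fy, smul_eq_mul]; ring
    have u0 : u ≠ 0 := by intro hz; rw [hz, map_zero] at fu; linarith
    have w0 : w ≠ 0 := by intro hz; rw [hz, map_zero] at fw; linarith
    have hden : 0 < (α + 2) * (β + 2) - 1 := by nlinarith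
    set δ := (α + 2) * (β + 2) - 1 with hδ
    refine ⟨hy, _, mk_mem_of_K h h4' u0, _, mk_mem_of_K h h5' w0, ⟨hx, ?_⟩, hy, ?_⟩
    · rw [cmap_mk h, cmap_mk h, fu, fw]
      refine ⟨(α + 1) / δ, (α + 2) * (β + 1) / δ, by positivity, by positivity, ?_, ?_⟩
      · rw [← add_div, div_eq_one_iff_eq hden.ne', hδ]; ring
      · rw [smul_smul, smul_smul]
        have r1 : (α + 1) / δ * (α + 1)⁻¹ = δ⁻¹ := by field_simp
        have r2 : (α + 2) * (β + 1) / δ * (β + 1)⁻¹ = δ⁻¹ * (α + 2) := by field_simp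
        rw [r1, r2, hu, hw]
        have : δ⁻¹ • ((α + 2) • cmap Ω y - cmap Ω x) +
          (δ⁻¹ * (α + 2)) • ((β + 2) • cmap Ω x - cmap Ω y) =
          (δ⁻¹ * ((α + 2) * (β + 2) - 1)) • cmap Ω x := by module
        rw [this, ← hδ, inv_mul_cancel₀ hden.ne', one_smul]
    · rw [cmap_mk h, cmap_mk h, fu, fw]
      refine ⟨(α + 1) * (β + 2) / δ, (β + 1) / δ, by positivity, by positivity, ?_, ?_⟩
      · rw [← add_div, div_eq_one_iff_eq hden.ne', hδ]; ring
      · rw [smul_smul, smul_smul]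
        have r1 : (α + 1) * (β + 2) / δ * (α + 1)⁻¹ = δ⁻¹ * (β + 2) := by field_simp
        have r2 : (β + 1) / δ * (β + 1)⁻¹ = δ⁻¹ := by field_simp
        rw [r1, r2, hu, hw]
        have : (δ⁻¹ * (β + 2)) • ((α + 2) • cmap Ω y - cmap Ω x) +
          δ⁻¹ • ((β + 2) • cmap Ω x - cmap Ω y) =
          (δ⁻¹ * ((α + 2) * (β + 2) - 1)) • cmap Ω y := by module
        rw [this, ← hδ, inv_mul_cancel₀ hden.ne', one_smul]

/-- vector version -/
lemma mk_mem_face {x : PSpace d} (hx : x ∈ closure Ω) {E : ℝ} {v : Fin d → ℝ} (hv0 : v ≠ 0)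
    (hv : (coneData Ω h).N E (cmap Ω x) v) : Projectivization.mk ℝ v hv0 ∈ face Ω x := by
  have hvK := hv.mem_right (cmap_mem_K h hx)
  have hf := (coneData Ω h).K_pos hvK hv0
  refine (mem_face_iff h hx).2 ⟨mk_mem_of_K h hvK hv0, E, ?_⟩
  rw [cmap_mk h]
  exact hv.smul_right (inv_pos.2 hf)

lemma face_sub {x : PSpace d} (hx : x ∈ closure Ω) : face Ω x ⊆ closure Ω :=
  fun _ hy => ((mem_face_iff h hx).1 hy).1

lemma N_combo {x y z : Fin d → ℝ} {E E' s t : ℝ}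
    (hs : 0 < s) (ht : 0 ≤ t) (hz : z ∈ (coneData Ω h).K) (h1 : (coneData Ω h).N E x y)
    (h2 : (coneData Ω h).N E' x z) : ∃ E'', (coneData Ω h).N E'' x (s • y + t • z) := by
  obtain ⟨α, β, p1, p2, -, p4, p5⟩ := h1
  obtain ⟨α', β', q1, q2, -, q4, q5⟩ := h2
  refine ConeData.N_of_dom (a := α / s) (b := s * β + t * β') (by positivity) (by positivity) ?_ ?_
  · have := (coneData Ω h).K_add p4 ((coneData Ω h).K_smul (show 0 ≤ α / s * t by positivity) hz)
    convert this using 1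
    have : (α / s) • (s • y + t • z) = (α / s * s) • y + (α / s * t) • z := by module
    rw [this, div_mul_cancel₀ _ hs.ne']; abel
  · have := (coneData Ω h).K_add ((coneData Ω h).K_smul hs.le p5) ((coneData Ω h).K_smul ht q5)
    convert this using 1; module

lemma N_combo' {x y z : Fin d → ℝ} {E E' s t : ℝ}
    (hs : 0 ≤ s) (ht : 0 ≤ t) (hst : 0 < s + t) (hy : y ∈ (coneData Ω h).K)
    (hz : z ∈ (coneData Ω h).K) (h1 : (coneData Ω h).N E x y)
    (h2 : (coneData Ω h).N E' x z) : ∃ E'', (coneData Ω h).N E'' x (s • y + t • z) := by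
  rcases hs.eq_or_lt with rfl | hs
  · rw [add_comm]
    exact N_combo h (by linarith) le_rfl hy h2 h1
  · exact N_combo h hs ht hz h1 h2

lemma face_pc {x : PSpace d} (hx : x ∈ closure Ω) : IsProperlyConvex (face Ω x) := by
  refine ⟨chartOf Ω, fun y hy => f_ne h ?_, ?_, ?_⟩
  · exact closure_minimal (face_sub h hx) isClosed_closure hy
  · rintro _ ⟨y, hy, rfl⟩ _ ⟨z, hz, rfl⟩ s t hs ht hst
    obtain ⟨hy1, E1, hy2⟩ := (mem_face_iff h hx).1 hy
    obtain ⟨hz1, E2, hz2⟩ := (mem_face_iff h hx).1 hz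
    obtain ⟨E3, hE3⟩ := N_combo' h hs ht (by linarith) (cmap_mem_K h hy1) (cmap_mem_K h hz1) hy2 hz2
    have hf : chartOf Ω (s • cmap Ω y + t • cmap Ω z) = 1 := by
      rw [map_add, map_smul, map_smul, f_cmap h hy1, f_cmap h hz1, smul_eq_mul, smul_eq_mul]
      linarith
    have h0 : s • cmap Ω y + t • cmap Ω z ≠ 0 := by
      intro hz; rw [hz, map_zero] at hf; linarith
    refine ⟨_, mk_mem_face h hx h0 hE3, ?_⟩
    rw [chartMap_mk, hf, inv_one, one_smul]; rfl
  · refine (Metric.isBounded_closedBall (x := (0 : Fin d → ℝ)) (r := (coneData Ω h).M)).subset ?_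
    rintro _ ⟨y, hy, rfl⟩
    have hy1 := face_sub h hx hy
    have := (coneData Ω h).K_bound (cmap_mem_K h hy1)
    have e : (coneData Ω h).f (cmap Ω y) = 1 := f_cmap h hy1
    rw [e, mul_one] at this
    rw [mem_closedBall_zero_iff]
    exact this

/-- sign of the chosen chart of the face -/
lemma face_sign {x : PSpace d} (hx : x ∈ closure Ω) :
    ∃ σ : ℝ, (σ = 1 ∨ σ = -1) ∧ ∀ y ∈ face Ω x, 0 < σ * chartOf (face Ω x) (cmap Ω y) := by
  set k := chartOf (face Ω x) with hk
  have hpc := chartOf_spec (face_pc h hx)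
  have hne : ∀ (E : ℝ) (v : Fin d → ℝ), v ≠ 0 → (coneData Ω h).N E (cmap Ω x) v → k v ≠ 0 := by
    intro E v hv0 hv
    have := hpc.1 _ (subset_closure (mk_mem_face h hx hv0 hv))
    exact (frep_mk _ v hv0).1 this
  have hxx : (coneData Ω h).N 1 (cmap Ω x) (cmap Ω x) := ConeData.N_refl
  have hkx := hne _ _ (cmap_ne h hx) hxx
  have hprod : ∀ y ∈ face Ω x, 0 < k (cmap Ω x) * k (cmap Ω y) := by
    intro y hy
    obtain ⟨hy1, E1, hy2⟩ := (mem_face_iff h hx).1 hy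
    have hky := hne _ _ (cmap_ne h hy1) hy2
    by_contra hle
    have hlt : k (cmap Ω x) * k (cmap Ω y) < 0 :=
      lt_of_le_of_ne (not_lt.1 hle) (mul_ne_zero hkx hky)
    obtain ⟨E3, hE3⟩ := N_combo h (abs_pos.2 hky) (abs_nonneg (k (cmap Ω x))) (cmap_mem_K h hy1)
      hxx hy2
    have hf : chartOf Ω (|k (cmap Ω y)| • cmap Ω x + |k (cmap Ω x)| • cmap Ω y) ≠ 0 := by
      rw [map_add, map_smul, map_smul, f_cmap h hy1, f_cmap h hx, smul_eq_mul, smul_eq_mul]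
      have := abs_pos.2 hky
      have := abs_pos.2 hkx
      linarith
    refine hne _ _ (fun hz => hf (by rw [hz, map_zero])) hE3 ?_
    rw [map_add, map_smul, map_smul, smul_eq_mul, smul_eq_mul]
    rcases mul_neg_iff.1 hlt with ⟨a, b⟩ | ⟨a, b⟩
    · rw [abs_of_neg b, abs_of_pos a]; ring
    · rw [abs_of_neg a, abs_of_pos b]; ring
  rcases lt_or_gt_of_ne hkx with hneg | hpos
  · refine ⟨-1, Or.inr rfl, fun y hy => ?_⟩
    have := hprod y hy
    nlinarith
  · refine ⟨1, Or.inl rfl, fun y hy => ?_⟩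
    have := hprod y hy
    rw [one_mul]
    exact (mul_pos_iff_of_pos_left hpos).1 this

lemma cmap_face {x y : PSpace d} (hx : x ∈ closure Ω) (hy : y ∈ face Ω x) :
    cmap (face Ω x) y = (chartOf (face Ω x) (cmap Ω y))⁻¹ • cmap Ω y := by
  have hy1 := face_sub h hx hy
  conv_lhs => rw [← mk_cmap h hy1]
  exact chartMap_mk _ _ _

lemma hilbert_face {x y z : PSpace d} (hx : x ∈ closure Ω) (hy : y ∈ face Ω x)
    (hz : z ∈ face Ω x) :
    (coneData Ω h).N (Real.exp (2 * hilbertDist (face Ω x) y z)) (cmap Ω y) (cmap Ω z) ∧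
    ∀ E, 1 ≤ E → (coneData Ω h).N E (cmap Ω y) (cmap Ω z) →
      hilbertDist (face Ω x) y z ≤ (1 / 2) * Real.log E := by
  by_cases hyz : cmap (face Ω x) y = cmap (face Ω x) z
  · have h1 : hilbertDist (face Ω x) y z = 0 := by
      unfold hilbertDist hilbertDistChart; rw [if_pos hyz]
    have hyz' : y = z := by
      have hpc := chartOf_spec (face_pc h hx)
      have e1 := mk_chartMap (chartOf (face Ω x)) y (hpc.1 y (subset_closure hy))
        (chartMap_ne _ y (hpc.1 y (subset_closure hy)))
      have e2 := mk_chartMap (chartOf (face Ω x)) z (hpc.1 z (subset_closure hz))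
        (chartMap_ne _ z (hpc.1 z (subset_closure hz)))
      rw [← e1, ← e2, Projectivization.mk_eq_mk_iff']
      exact ⟨1, by rw [one_smul]; exact hyz.symm⟩
    rw [h1]
    subst hyz'
    refine ⟨by simpa using ConeData.N_refl, fun E hE _ => ?_⟩
    have := Real.log_nonneg hE
    linarith
  obtain ⟨σ, hσ, hpos⟩ := face_sign h hx
  have hσσ : σ * σ = 1 := by rcases hσ with rfl | rfl <;> norm_num
  have hσ0 : σ ≠ 0 := by rintro rfl; simp at hσσ
  obtain ⟨hy1, E1, hy2⟩ := (mem_face_iff h hx).1 hy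
  obtain ⟨hz1, E2, hz2⟩ := (mem_face_iff h hx).1 hz
  set D := coneData Ω h with hD
  set k := chartOf (face Ω x) with hk
  set u := cmap (face Ω x) y with hu
  set w := cmap (face Ω x) z with hw
  have hpc := chartOf_spec (face_pc h hx)
  -- positive multiples
  have hmul : ∀ y ∈ face Ω x, ∃ c : ℝ, 0 < c ∧ σ • cmap (face Ω x) y = c • cmap Ω y := by
    intro y hy
    refine ⟨(σ * k (cmap Ω y))⁻¹, inv_pos.2 (hpos y hy), ?_⟩
    rw [cmap_face h hx hy, smul_smul]
    congr 1
    rw [mul_inv, show σ⁻¹ = σ from inv_eq_of_mul_eq_one_left hσσ]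
  obtain ⟨cy, hcy, ey⟩ := hmul y hy
  obtain ⟨cz, hcz, ez⟩ := hmul z hz
  have hO : ∀ p : Fin d → ℝ, k p = 1 → (p ∈ cmap (face Ω x) '' face Ω x ↔
      ∃ E, D.N E (cmap Ω x) (σ • p)) := by
    intro p hp
    constructor
    · rintro ⟨q, hq, rfl⟩
      obtain ⟨c, hc, e⟩ := hmul q hq
      obtain ⟨-, E, hE⟩ := (mem_face_iff h hx).1 hq
      exact ⟨E, by rw [e]; exact hE.smul_right hc⟩
    · rintro ⟨E, hE⟩
      have hp0 : p ≠ 0 := by rintro rfl; simp at hp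
      have hσp : σ • p ≠ 0 := smul_ne_zero hσ0 hp0
      refine ⟨_, mk_mem_face h hx hσp hE, ?_⟩
      have : cmap (face Ω x) (Projectivization.mk ℝ (σ • p) hσp) = (k (σ • p))⁻¹ • σ • p :=
        chartMap_mk _ _ _
      rw [this, map_smul, hp, smul_eq_mul, mul_one, smul_smul, inv_mul_cancel₀ hσ0, one_smul]
  have ku : k u = 1 := f_chartMap _ y (hpc.1 y (subset_closure hy))
  have kw : k w = 1 := f_chartMap _ z (hpc.1 z (subset_closure hz))
  have hxu : D.N E1 (cmap Ω x) (σ • u) := by rw [ey]; exact hy2.smul_right hcy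
  have hxw : D.N E2 (cmap Ω x) (σ • w) := by rw [ez]; exact hz2.smul_right hcz
  have huK : σ • u ∈ D.K := hxu.mem_right (cmap_mem_K h hx)
  have hwK : σ • w ∈ D.K := hxw.mem_right (cmap_mem_K h hx)
  have huw := hxu.symm.trans hxw
  have hT : ∀ t : ℝ, t ∈ {t : ℝ | u + t • (w - u) ∈ cmap (face Ω x) '' face Ω x} ↔
      ∃ E, D.N E (σ • u) (σ • u + t • (σ • w - σ • u)) := by
    intro t
    have e : σ • u + t • (σ • w - σ • u) = σ • (u + t • (w - u)) := by module
    rw [Set.mem_ofPred_eq, hO _ (by rw [map_add, map_smul, map_sub, ku, kw]; simp), e]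
    constructor
    · rintro ⟨E, hE⟩; exact ⟨_, hxu.symm.trans hE⟩
    · rintro ⟨E, hE⟩; exact ⟨_, hxu.trans hE⟩
  obtain ⟨M, hM⟩ := hpc.2.2.exists_norm_le
  have hwu : 0 < ‖w - u‖ := norm_pos_iff.2 (sub_ne_zero.2 (Ne.symm hyz))
  have hbd : ∀ t ∈ {t : ℝ | u + t • (w - u) ∈ cmap (face Ω x) '' face Ω x},
      |t| ≤ (M + ‖u‖) / ‖w - u‖ := by
    intro t ht
    have h1 := hM _ ht
    rw [le_div_iff₀ hwu, ← Real.norm_eq_abs, ← norm_smul]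
    have h2 : t • (w - u) = (u + t • (w - u)) - u := by abel
    rw [h2]
    exact (norm_sub_le _ _).trans (by linarith)
  have hmain := ConeData.hilb huK hwK huw _ hT
    ⟨_, fun t ht => (le_abs_self t).trans (hbd t ht)⟩
    ⟨-((M + ‖u‖) / ‖w - u‖), fun t ht => (neg_le_neg (hbd t ht)).trans (neg_abs_le t)⟩
  have hdist : hilbertDist (face Ω x) y z = (1 / 2) * Real.log
      ((sSup {t : ℝ | u + t • (w - u) ∈ cmap (face Ω x) '' face Ω x} *
        (1 - sInf {t : ℝ | u + t • (w - u) ∈ cmap (face Ω x) '' face Ω x})) /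
        ((-(sInf {t : ℝ | u + t • (w - u) ∈ cmap (face Ω x) '' face Ω x})) *
          (sSup {t : ℝ | u + t • (w - u) ∈ cmap (face Ω x) '' face Ω x} - 1))) := by
    unfold hilbertDist hilbertDistChart; rw [if_neg hyz]
  rw [← hdist, ey, ez] at hmain
  constructor
  · have := hmain.1.smul_left (inv_pos.2 hcy)
    rw [smul_smul, inv_mul_cancel₀ hcy.ne', one_smul] at this
    exact (ConeData.N_smul_right_iff hcz).1 this
  · intro E _ hE
    exact hmain.2 E ((hE.smul_left hcy).smul_right hcz)

/-- consequence of small coarse dimension -/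
lemma cdim_face {x : PSpace d} (hx : x ∈ closure Ω) {A : Set (PSpace d)} (hA : A ⊆ face Ω x)
    (hc : cdim (face Ω x) A ≤ 1) :
    ∃ E : ℝ, ∃ W : Submodule ℝ (Fin d → ℝ), Module.finrank ℝ W ≤ 2 ∧
      ∀ p ∈ A, ∃ q ∈ W, (coneData Ω h).N E (cmap Ω p) q := by
  have hpc := chartOf_spec (face_pc h hx)
  have hne : {k : ℕ | ∃ R : ℝ, 0 < R ∧ ∃ B : Set (PSpace d), B ⊆ face Ω x ∧
    Convex ℝ (cmap (face Ω x) '' B) ∧ pdimIn (face Ω x) B = k ∧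
    A ⊆ {p ∈ face Ω x | ∃ q ∈ B, hilbertDist (face Ω x) p q < R}}.Nonempty := by
    refine ⟨pdimIn (face Ω x) (face Ω x), 1, one_pos, face Ω x, Subset.rfl, hpc.2.1, rfl,
      fun p hp => ⟨hA hp, p, hA hp, ?_⟩⟩
    unfold hilbertDist hilbertDistChart
    rw [if_pos rfl]; exact one_pos
  obtain ⟨R, hR, B, hBF, -, hdim, hAB⟩ := Nat.sInf_mem hne
  have hdim1 : Module.finrank ℝ (affineSpan ℝ (cmap (face Ω x) '' B)).direction ≤ 1 := by
    have : pdimIn (face Ω x) B ≤ 1 := by rw [hdim]; exact hc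
    exact this
  rcases B.eq_empty_or_nonempty with rfl | ⟨b0, hb0⟩
  · refine ⟨1, ⊥, by simp, fun p hp => ?_⟩
    obtain ⟨-, q, hq, -⟩ := hAB hp
    exact absurd hq (notMem_empty q)
  set dir := (affineSpan ℝ (cmap (face Ω x) '' B)).direction with hdir
  refine ⟨Real.exp (2 * R), Submodule.span ℝ {cmap (face Ω x) b0} ⊔ dir, ?_, ?_⟩
  · have h1 := Submodule.finrank_add_le_finrank_add_finrank
      (Submodule.span ℝ {cmap (face Ω x) b0}) dir
    have h2 := finrank_span_le_card (R := ℝ) ({cmap (face Ω x) b0} : Set (Fin d → ℝ))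
    simp only [toFinset_singleton, Finset.card_singleton] at h2
    omega
  · intro p hp
    obtain ⟨hpF, q, hq, hpq⟩ := hAB hp
    have hqF := hBF hq
    refine ⟨cmap Ω q, ?_, ?_⟩
    · have hqW : cmap (face Ω x) q ∈ Submodule.span ℝ {cmap (face Ω x) b0} ⊔ dir := by
        have h1 : cmap (face Ω x) q - cmap (face Ω x) b0 ∈ dir :=
          AffineSubspace.vsub_mem_direction (subset_affineSpan ℝ _ ⟨q, hq, rfl⟩)
            (subset_affineSpan ℝ _ ⟨b0, hb0, rfl⟩)
        have := Submodule.add_mem_sup (Submodule.mem_span_singleton_self (R := ℝ)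
          (cmap (face Ω x) b0)) h1
        simpa using this
      have hkq : chartOf (face Ω x) (cmap Ω q) ≠ 0 := by
        obtain ⟨σ, -, hpos⟩ := face_sign h hx
        intro h0
        have := hpos q hqF
        rw [h0, mul_zero] at this; exact lt_irrefl _ this
      have := Submodule.smul_mem _ (chartOf (face Ω x) (cmap Ω q)) hqW
      rwa [cmap_face h hx hqF, smul_smul, mul_inv_cancel₀ hkq, one_smul] at this
    · refine (hilbert_face h hx hpF hqF).1.mono ?_
      exact Real.exp_le_exp.2 (by linarith)

end faces

lemma pact_mk (g : (Fin d → ℝ) ≃ₗ[ℝ] (Fin d → ℝ)) (v : Fin d → ℝ) (hv : v ≠ 0) (hgv : g v ≠ 0) :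
    pact g (Projectivization.mk ℝ v hv) = Projectivization.mk ℝ (g v) hgv := by
  unfold pact
  exact Projectivization.map_mk _ _ _ _

lemma lift_map {A : Set (PSpace d)} {g : (Fin d → ℝ) ≃ₗ[ℝ] (Fin d → ℝ)} (hg : pact g '' A = A)
    {v : Fin d → ℝ} (hv : v ∈ lift A) : g v ∈ lift A := by
  obtain ⟨h0, hm⟩ := hv
  have hgv : g v ≠ 0 := by simpa using h0
  refine ⟨hgv, ?_⟩
  rw [← pact_mk g v h0 hgv, ← hg]
  exact ⟨_, hm, rfl⟩

lemma map_K0 {Ω : Set (PSpace d)} (h : IsPCDomain Ω) {g : (Fin d → ℝ) ≃ₗ[ℝ] (Fin d → ℝ)}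
    (hg : pact g '' Ω = Ω) {v : Fin d → ℝ} (hv : v ∈ (coneData Ω h).K0)
    (hgv : 0 < chartOf Ω (g v)) {x : Fin d → ℝ} (hx : x ∈ (coneData Ω h).K0) :
    g x ∈ (coneData Ω h).K0 := by
  have hne : ∀ w ∈ (coneData Ω h).K0, chartOf Ω (g w) ≠ 0 := by
    intro w hw
    obtain ⟨h0, hm⟩ := lift_map hg hw.2
    exact (frep_mk _ _ h0).1 (f_ne h (subset_closure hm))
  refine ⟨?_, lift_map hg hx.2⟩
  by_contra hle
  have hlt : chartOf Ω (g x) < 0 := lt_of_le_of_ne (not_lt.1 hle) (hne x hx)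
  have hmem := (coneData Ω h).add_mem _ ((coneData Ω h).smul_mem _ (neg_pos.2 hlt) _ hv) _
    ((coneData Ω h).smul_mem _ hgv _ hx)
  apply hne _ hmem
  rw [map_add, map_smul, map_smul, map_add, map_smul, map_smul, smul_eq_mul, smul_eq_mul]
  ring

lemma NCCTriple.pc (T : NCCTriple d) : IsPCDomain T.Ω :=
  ⟨T.isOpen_Ω, T.nonempty_Ω, T.properlyConvex_Ω⟩

/-- cone data of the triple -/
def NCCTriple.D (T : NCCTriple d) : ConeData (Fin d → ℝ) := coneData T.Ω T.pc

/-- closed cone over `C` -/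
def NCCTriple.Q (T : NCCTriple d) : Set (Fin d → ℝ) := closure (cone (chartOf T.Ω) T.C)

lemma NCCTriple.Q_sub (T : NCCTriple d) : T.Q ⊆ T.D.K :=
  closure_mono fun _ hv => ⟨hv.1, hv.2.1, T.C_sub hv.2.2⟩

lemma NCCTriple.fC (T : NCCTriple d) : ∀ x ∈ closure T.C, chartOf T.Ω x.rep ≠ 0 :=
  fun _ hx => f_ne T.pc (closure_mono T.C_sub hx)

lemma NCCTriple.mem_Q_iff (T : NCCTriple d) {v : Fin d → ℝ} (h0 : v ≠ 0)
    (hf : 0 < chartOf T.Ω v) :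
    Projectivization.mk ℝ v h0 ∈ closure T.C ↔ v ∈ T.Q :=
  cone_closure_iff _ T.fC h0 hf

lemma NCCTriple.Q_f (T : NCCTriple d) {v : Fin d → ℝ} (hv : v ∈ T.Q) (h0 : v ≠ 0) :
    0 < chartOf T.Ω v := T.D.K_pos (T.Q_sub hv) h0

lemma NCCTriple.Q_add (T : NCCTriple d) : ∀ x ∈ T.Q, ∀ y ∈ T.Q, x + y ∈ T.Q :=
  fun _ hx _ hy => map_mem_closure₂ continuous_add hx hy fun _ ha _ hb =>
    cone_add _ (fun x hx => T.fC x (subset_closure hx)) T.C_convex ha hb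

lemma NCCTriple.Q_smul (T : NCCTriple d) : ∀ t : ℝ, 0 < t → ∀ x ∈ T.Q, t • x ∈ T.Q :=
  fun t ht _ hx => map_mem_closure (continuous_const_smul t) hx fun _ ha => cone_smul _ ht ha

lemma NCCTriple.mem_C (T : NCCTriple d) {v : Fin d → ℝ} (hv : v ∈ T.Q) (hv' : v ∈ T.D.K0) :
    ∃ h0 : v ≠ 0, Projectivization.mk ℝ v h0 ∈ T.C := by
  obtain ⟨hf, h0, hm⟩ := hv'
  exact ⟨h0, T.C_closedInΩ ⟨(T.mem_Q_iff h0 hf).2 hv, hm⟩⟩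

lemma NCCTriple.mem_ideal (T : NCCTriple d) {v : Fin d → ℝ} (hv : v ∈ T.Q) (hv' : v ∉ T.D.K0)
    (h0 : v ≠ 0) : Projectivization.mk ℝ v h0 ∈ idealBdry T.C := by
  have hf := T.Q_f hv h0
  exact ⟨(T.mem_Q_iff h0 hf).2 hv, fun hm => hv' ⟨hf, h0, T.C_sub hm⟩⟩

lemma NCCTriple.group (T : NCCTriple d) {Kc : Set (PSpace d)}
    (hKc : T.C ⊆ ⋃ g ∈ T.Λ, pact g '' Kc) :
    ∀ v ∈ T.Q, v ∈ T.D.K0 → ∃ g : (Fin d → ℝ) ≃ₗ[ℝ] (Fin d → ℝ),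
      (∀ x, g x ∈ T.D.K0 ↔ x ∈ T.D.K0) ∧ (∀ x ∈ T.Q, g x ∈ T.Q) ∧
      ∃ t : ℝ, 0 < t ∧ t • g v ∈ chartMap (chartOf T.Ω) '' Kc := by
  intro v hv hv'
  obtain ⟨h0, hC⟩ := T.mem_C hv hv'
  have hU := hKc hC
  simp only [mem_iUnion] at hU
  obtain ⟨γ, hγ, k, hk, hkv⟩ := hU
  have hkrep : k = Projectivization.mk ℝ k.rep k.rep_nonzero := (Projectivization.mk_rep k).symm
  -- generic sign
  have hinv : ∀ g : (Fin d → ℝ) ≃ₗ[ℝ] (Fin d → ℝ), g.toLinearMap.comp γ.toLinearMap =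
      LinearMap.id ∨ g.toLinearMap.comp γ.toLinearMap = -LinearMap.id →
      (∀ x : PSpace d, pact g (pact γ x) = x) := by
    intro g hg x
    induction x using Projectivization.ind with | h x hx => ?_
    have h1 : γ x ≠ 0 := by simpa using hx
    have h2 : g (γ x) ≠ 0 := by simpa using hx
    rw [pact_mk γ x hx h1, pact_mk g _ h1 h2, Projectivization.mk_eq_mk_iff']
    rcases hg with hg | hg
    · exact ⟨1, by rw [one_smul]; exact (LinearMap.congr_fun hg x).symm⟩
    · exact ⟨-1, by rw [neg_one_smul]; exact (LinearMap.congr_fun hg x).symm⟩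
  obtain ⟨g, hg, hgv⟩ : ∃ g : (Fin d → ℝ) ≃ₗ[ℝ] (Fin d → ℝ), (∀ x : PSpace d, pact g (pact γ x) = x)
      ∧ 0 < chartOf T.Ω (g v) := by
    have a1 := hinv γ.symm (Or.inl (by ext1; simp))
    have hne : chartOf T.Ω (γ.symm v) ≠ 0 := by
      have h2 : γ.symm v ≠ 0 := by simpa using h0
      have : Projectivization.mk ℝ (γ.symm v) h2 = k := by
        rw [← pact_mk γ.symm v h0 h2, ← hkv, a1]
      have hk' : k ∈ T.Ω := by
        have h3 : pact γ k ∈ pact γ '' T.Ω := by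
          rw [T.inv_Ω γ hγ, hkv]; exact T.C_sub hC
        obtain ⟨k', hk', e⟩ := h3
        have := congrArg (pact γ.symm) e
        rw [a1, a1] at this
        rwa [← this]
      rw [← this] at hk'
      exact (frep_mk _ _ h2).1 (f_ne T.pc (subset_closure hk'))
    rcases lt_or_gt_of_ne hne with hlt | hgt
    · refine ⟨γ.symm.trans (LinearEquiv.neg ℝ), hinv _ (Or.inr ?_), ?_⟩
      · refine LinearMap.ext fun x => ?_
        simp
      · simpa using hlt
    · exact ⟨γ.symm, a1, hgt⟩
  have himg : ∀ A : Set (PSpace d), pact γ '' A = A → pact g '' A = A := by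
    intro A hA
    conv_lhs => rw [← hA]
    rw [image_image]
    simp only [hg, image_id']
  have gΩ := himg _ (T.inv_Ω γ hγ)
  have gC := himg _ (T.inv_C γ hγ)
  have hgΩ : pact g.symm '' T.Ω = T.Ω := by
    conv_lhs => rw [← gΩ]
    rw [image_image]
    refine Eq.trans (image_congr fun x _ => ?_) (image_id' T.Ω)
    induction x using Projectivization.ind with | h x hx => ?_
    have h1 : g x ≠ 0 := by simpa using hx
    rw [pact_mk g x hx h1, pact_mk g.symm _ h1 (by simpa using hx)]
    simp
  have fwd : ∀ x ∈ T.D.K0, g x ∈ T.D.K0 := fun x hx => map_K0 T.pc gΩ hv' hgv hx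
  have hgvK := fwd v hv'
  refine ⟨g, fun x => ⟨fun hx => ?_, fwd x⟩, ?_, ?_⟩
  · have := map_K0 T.pc hgΩ hgvK (by simpa using hv'.1) hx
    rw [LinearEquiv.symm_apply_apply] at this
    exact this
  · intro x hx
    refine map_mem_closure (LinearMap.continuous_of_finiteDimensional g.toLinearMap) hx ?_
    intro a ha
    exact ⟨(fwd a ⟨ha.1, ha.2.1, T.C_sub ha.2.2⟩).1, lift_map gC ha.2⟩
  · refine ⟨(chartOf T.Ω (g v))⁻¹, inv_pos.2 hgv, k, hk, ?_⟩
    have h2 : g v ≠ 0 := by simpa using h0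
    have : k = Projectivization.mk ℝ (g v) h2 := by
      rw [← pact_mk g v h0 h2, ← hkv, hg]
    rw [this, chartMap_mk]

lemma NCCTriple.faces (T : NCCTriple d)
    (hcdim : ∀ x ∈ idealBdry T.C, cdim (face T.Ω x) (idealBdry T.C ∩ face T.Ω x) ≤ 1) :
    ∀ x ∈ T.Q, x ∉ T.D.K0 → x ≠ 0 → ∃ E : ℝ, ∃ W : Submodule ℝ (Fin d → ℝ),
      Module.finrank ℝ W ≤ 2 ∧ ∀ p ∈ T.Q, (∃ E', T.D.N E' x p) → ∃ q ∈ W, T.D.N E p q := by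
  intro x hx hx' h0
  have hid := T.mem_ideal hx hx' h0
  have hcl : Projectivization.mk ℝ x h0 ∈ closure T.Ω := closure_mono T.C_sub hid.1
  obtain ⟨E, W, hW, hq⟩ := cdim_face T.pc hcl inter_subset_right (hcdim _ hid)
  refine ⟨E, W, hW, ?_⟩
  rintro p hp ⟨E', hE'⟩
  have fx := T.Q_f hx h0
  have hp' : p ∉ T.D.K0 := by
    intro hp'
    obtain ⟨α, β, h1, h2, -, h3, h4⟩ := hE'
    exact hx' (T.D.K0_of_le h2 hp' h4)
  have hp0 : p ≠ 0 := by
    rintro rfl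
    obtain ⟨α, β, h1, h2, -, h3, h4⟩ := hE'
    have := T.D.K_nonneg h3
    rw [smul_zero, zero_sub, map_neg] at this
    have fx' : 0 < T.D.f x := fx
    linarith
  have fp := T.Q_f hp hp0
  have hmem := mk_mem_face T.pc hcl hp0 (E := E') (by
    rw [cmap_mk T.pc]; exact hE'.smul_left (inv_pos.2 fx))
  obtain ⟨q, hqW, hN⟩ := hq _ ⟨T.mem_ideal hp hp' hp0, hmem⟩
  refine ⟨q, hqW, ?_⟩
  rw [cmap_mk T.pc] at hN
  have := hN.smul_left fp
  rwa [smul_smul, mul_inv_cancel₀ fp.ne', one_smul] at this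

lemma NCCTriple.main (T : NCCTriple d)
    (hcdim : ∀ x ∈ idealBdry T.C, cdim (face T.Ω x) (idealBdry T.C ∩ face T.Ω x) ≤ 1) :
    ∃ E : ℝ, 1 < E ∧ ∀ a ∈ T.Q, ∀ b ∈ T.Q, ∀ c ∈ T.Q, ∀ y ∈ T.Q, ∀ z ∈ T.Q,
      a + b + c ∈ T.D.K0 → a + b ∉ T.D.K0 → a + c ∉ T.D.K0 → y ≠ 0 → z ≠ 0 →
      (∃ E', T.D.N E' a y) → (∃ E', T.D.N E' a z) → T.D.N E y z := by
  obtain ⟨Kc, hK1, hK2, hK3⟩ := T.cocompact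
  refine ConeData.core T.D T.Q (chartMap (chartOf T.Ω) '' Kc) T.Q_sub isClosed_closure T.Q_add
    T.Q_smul ?_ ?_ (T.group hK3) (T.faces hcdim)
  · exact hK2.image_of_continuousOn ((continuousOn_chartMap _).mono fun x hx =>
      T.fC x (subset_closure (hK1 hx)))
  · rintro _ ⟨x, hx, rfl⟩
    have hf := T.fC x (subset_closure (hK1 hx))
    refine ⟨?_, chartMap_ne _ x hf, ?_⟩
    · rw [f_chartMap _ x hf]; exact one_pos
    · rw [mk_chartMap _ x hf]; exact T.C_sub (hK1 hx)

/-- vertex configuration -/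
lemma NCCTriple.vertices (T : NCCTriple d) {S : Set (PSpace d)} {v : Fin 3 → PSpace d}
    (hv : HasVertices S v) (hSC : S ⊆ T.C) (hS : IsProperlyEmbedded S T.C) :
    ∃ a : Fin 3 → (Fin d → ℝ), (∀ j, a j ∈ T.Q ∧ ∃ h0 : a j ≠ 0, Projectivization.mk ℝ (a j) h0 = v j)
      ∧ a 0 + a 1 + a 2 ∈ T.D.K0 ∧ a 0 + a 1 ∉ T.D.K0 ∧ a 0 + a 2 ∉ T.D.K0 ∧
        a 1 + a 2 ∉ T.D.K0 := by
  obtain ⟨hp, g, hSg, hvj⟩ := hv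
  let w : (Fin 3 → ℝ) → (Fin d → ℝ) := fun c => ∑ j, c j • Pi.single (Fin.castLE hp j) (1:ℝ)
  have hw : ∀ c (j : Fin 3), w c (Fin.castLE hp j) = c j := by
    intro c j
    simp only [w, Finset.sum_apply, Pi.smul_apply, Pi.single_apply, smul_eq_mul]
    simp [Finset.sum_ite_eq]
  have hw' : ∀ c (i : Fin d), 3 ≤ (i : ℕ) → w c i = 0 := by
    intro c i hi
    simp only [w, Finset.sum_apply, Pi.smul_apply, Pi.single_apply, smul_eq_mul]
    refine Finset.sum_eq_zero fun j _ => ?_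
    rw [if_neg, mul_zero]
    intro e
    have := congrArg Fin.val e
    simp at this
    omega
  have hwne : ∀ c, c ≠ 0 → w c ≠ 0 := by
    intro c hc e
    apply hc
    ext j
    rw [← hw c j, e]; rfl
  have hgne : ∀ c, c ≠ 0 → g (w c) ≠ 0 := fun c hc => by simpa using hwne c hc
  have hpos : ∀ c : Fin 3 → ℝ, (∀ j, 0 < c j) → g (w c) ∈ lift S := by
    intro c hc
    have hc0 : c ≠ 0 := fun e => by simpa [e] using hc 0
    refine ⟨hgne c hc0, ?_⟩
    rw [hSg]
    refine ⟨w c, ⟨?_, hw' c⟩, hwne c hc0, rfl⟩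
    intro i hi
    have : i = Fin.castLE hp ⟨i, hi⟩ := rfl
    rw [this, hw]; exact hc _
  have hwc : Continuous fun c => g (w c) := by
    refine (LinearMap.continuous_of_finiteDimensional g.toLinearMap).comp ?_
    simp only [w]; fun_prop
  have hnn : ∀ c : Fin 3 → ℝ, (∀ j, 0 ≤ c j) → g (w c) ∈ closure (lift S) := by
    intro c hc
    have hcc : c ∈ closure {c : Fin 3 → ℝ | ∀ j, 0 < c j} := by
      have ht : Tendsto (fun n : ℕ => fun j => c j + 1 / ((n : ℝ) + 1)) atTop (nhds c) := by
        rw [tendsto_pi_nhds]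
        intro j
        simpa using (tendsto_const_nhds (x := c j)).add
          (tendsto_one_div_add_atTop_nhds_zero_nat (𝕜 := ℝ))
      refine mem_closure_of_tendsto ht (Eventually.of_forall fun n j => ?_)
      have := hc j
      positivity
    exact map_mem_closure (f := fun c => g (w c)) hwc hcc fun c hc => hpos c hc
  have hnnS : ∀ c : Fin 3 → ℝ, (∀ j, 0 ≤ c j) → ∀ hc : c ≠ 0,
      Projectivization.mk ℝ (g (w c)) (hgne c hc) ∈ closure S :=
    fun c hc h0 => mk_mem_closure _ (hnn c hc)
  have hfne : ∀ c : Fin 3 → ℝ, (∀ j, 0 ≤ c j) → c ≠ 0 → chartOf T.Ω (g (w c)) ≠ 0 :=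
    fun c hc h0 => (frep_mk _ _ (hgne c h0)).1 (T.fC _ (closure_mono hSC (hnnS c hc h0)))
  have hadd : ∀ c c', g (w (c + c')) = g (w c) + g (w c') := by
    intro c c'
    rw [← map_add]; congr 1
    simp only [w, Pi.add_apply, add_smul, Finset.sum_add_distrib]
  have hsm : ∀ (t : ℝ) c, g (w (t • c)) = t • g (w c) := by
    intro t c
    rw [← map_smul]; congr 1
    simp only [w, Pi.smul_apply, smul_eq_mul, mul_smul, Finset.smul_sum]
  have hsign : ∀ c c' : Fin 3 → ℝ, (∀ j, 0 ≤ c j) → (∀ j, 0 < c' j) → c ≠ 0 →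
      0 < chartOf T.Ω (g (w c)) * chartOf T.Ω (g (w c')) := by
    intro c c' hc hc' h0
    have h0' : c' ≠ 0 := fun e => by simpa [e] using hc' 0
    have n1 := hfne c hc h0
    have n2 := hfne c' (fun j => (hc' j).le) h0'
    by_contra hle
    have hlt := lt_of_le_of_ne (not_lt.1 hle) (mul_ne_zero n1 n2)
    have hm : ∀ j, 0 < (|chartOf T.Ω (g (w c'))| • c + |chartOf T.Ω (g (w c))| • c') j := by
      intro j
      have := mul_pos (abs_pos.2 n1) (hc' j)
      have := mul_nonneg (abs_nonneg (chartOf T.Ω (g (w c')))) (hc j)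
      simp only [Pi.add_apply, Pi.smul_apply, smul_eq_mul]
      linarith
    refine hfne _ (fun j => (hm j).le) (fun e => by have := hm 0; rw [e] at this; simp at this) ?_
    rw [hadd, hsm, hsm, map_add, map_smul, map_smul, smul_eq_mul, smul_eq_mul]
    rcases mul_neg_iff.1 hlt with ⟨a, b⟩ | ⟨a, b⟩
    · rw [abs_of_neg b, abs_of_pos a]; ring
    · rw [abs_of_neg a, abs_of_pos b]; ring
  obtain ⟨σ, hσ0, hσ⟩ : ∃ σ : ℝ, σ ≠ 0 ∧ ∀ c : Fin 3 → ℝ, (∀ j, 0 ≤ c j) → c ≠ 0 →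
      0 < chartOf T.Ω (σ • g (w c)) := by
    refine ⟨chartOf T.Ω (g (w 1)), hfne 1 (fun j => zero_le_one) one_ne_zero, fun c hc h0 => ?_⟩
    rw [map_smul, smul_eq_mul, mul_comm]
    exact hsign c 1 hc (fun j => one_pos) h0
  -- closedness
  have hclosed : closure S ∩ T.C ⊆ S := by
    obtain ⟨hsub, hprop⟩ := hS
    have hc := hprop.isClosedMap _ isClosed_univ
    rw [image_univ, Set.range_inclusion] at hc
    rintro x ⟨hx, hxC⟩
    have : (⟨x, hxC⟩ : T.C) ∈ closure {x : T.C | (x : PSpace d) ∈ S} := by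
      rw [closure_subtype]
      refine closure_mono ?_ hx
      intro y hy
      exact ⟨⟨y, hsub hy⟩, hy, rfl⟩
    rw [IsClosed.closure_eq hc] at this
    exact this
  have hnot : ∀ c : Fin 3 → ℝ, (∀ j, 0 ≤ c j) → (hc0 : c ≠ 0) → (∃ j, c j = 0) →
      σ • g (w c) ∉ T.D.K0 := by
    rintro c hc hc0 ⟨j, hj⟩ ⟨hf, h0, hm⟩
    rw [mk_smul _ (hgne c hc0) σ hσ0] at hm
    have hcl := hnnS c hc hc0
    have hmS := hclosed ⟨hcl, T.C_closedInΩ ⟨closure_mono hSC hcl, hm⟩⟩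
    rw [hSg] at hmS
    obtain ⟨u, hu, hu0, e⟩ := hmS
    rw [Projectivization.mk_eq_mk_iff'] at e
    obtain ⟨r, hr⟩ := e
    rw [← map_smul] at hr
    have hr' := congrFun (g.injective hr) (Fin.castLE hp j)
    have hup := hu.1 (Fin.castLE hp j) (by simp)
    rw [hw, hj, Pi.smul_apply, smul_eq_mul] at hr'
    have hr0 : r = 0 := by
      rcases mul_eq_zero.1 hr' with h | h
      · exact h
      · exact absurd h hup.ne'
    rw [hr0, zero_smul, map_zero] at hr
    exact hgne c hc0 hr.symm
  have hsingle : ∀ j : Fin 3, ∀ k, 0 ≤ (Pi.single j (1:ℝ) : Fin 3 → ℝ) k := by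
    intro j k
    rw [Pi.single_apply]; split_ifs <;> norm_num
  have hs0 : ∀ j : Fin 3, (Pi.single j (1:ℝ) : Fin 3 → ℝ) ≠ 0 := by
    intro j; simp
  have hws : ∀ j : Fin 3, w (Pi.single j 1) = Pi.single (Fin.castLE hp j) 1 := by
    intro j
    simp only [w]
    rw [Finset.sum_eq_single j]
    · simp
    · intro b _ hb
      simp [Pi.single_apply, hb]
    · simp
  have hpair : ∀ i j k : Fin 3, k ≠ i → k ≠ j → σ • g (w (Pi.single i 1)) + σ • g (w (Pi.single j 1)) ∉ T.D.K0 := by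
    intro i j k hi hj
    rw [← smul_add, ← hadd]
    refine hnot _ (fun l => add_nonneg (hsingle i l) (hsingle j l)) ?_ ⟨k, ?_⟩
    · intro e
      have := congrFun e i
      have h1 := hsingle j i
      rw [Pi.add_apply, Pi.single_eq_same, Pi.zero_apply] at this
      linarith
    · rw [Pi.add_apply, Pi.single_eq_of_ne hi, Pi.single_eq_of_ne hj, add_zero]
  refine ⟨fun j => σ • g (w (Pi.single j 1)), fun j => ?_, ?_, hpair 0 1 2 (by decide) (by decide),
    hpair 0 2 1 (by decide) (by decide), hpair 1 2 0 (by decide) (by decide)⟩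
  · have h0 : σ • g (w (Pi.single j 1)) ≠ 0 := smul_ne_zero hσ0 (hgne _ (hs0 j))
    refine ⟨?_, h0, ?_⟩
    · refine (T.mem_Q_iff h0 (hσ _ (hsingle j) (hs0 j))).1 ?_
      rw [mk_smul _ (hgne _ (hs0 j)) σ hσ0]
      exact closure_mono hSC (hnnS _ (hsingle j) (hs0 j))
    · rw [mk_smul _ (hgne _ (hs0 j)) σ hσ0, hvj]
      congr 1
      rw [hws]
  · show σ • g (w (Pi.single 0 1)) + σ • g (w (Pi.single 1 1)) + σ • g (w (Pi.single 2 1)) ∈ _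
    rw [← smul_add, ← hadd, ← smul_add, ← hadd]
    have e : (Pi.single 0 1 + Pi.single 1 1 + Pi.single 2 1 : Fin 3 → ℝ) = 1 := by
      ext j; fin_cases j <;> simp
    rw [e]
    refine ⟨hσ 1 (fun j => zero_le_one) one_ne_zero, lift_smul hσ0 ?_⟩
    obtain ⟨h0, hm⟩ := hpos 1 (fun j => one_pos)
    exact ⟨h0, T.C_sub (hSC hm)⟩

/-- Lemma 7.1: if all faces of the ideal boundary of a naive convex
co-compact triple have coarse dimension at most one, then the faces of the vertices of
properly embedded two-dimensional simplices in `C` have uniformly bounded trace of `∂_i C`. -/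
theorem uniform_bound_on_vertex_faces {d : ℕ} (T : NCCTriple d)
    (hcdim : ∀ x ∈ idealBdry T.C, cdim (face T.Ω x) (idealBdry T.C ∩ face T.Ω x) ≤ 1) :
    ∃ R : ℝ, 0 < R ∧ ∀ S : Set (PSpace d), ∀ v : Fin 3 → PSpace d,
      HasVertices S v → S ⊆ T.C → IsProperlyEmbedded S T.C →
      ∀ j : Fin 3, ∀ y ∈ idealBdry T.C ∩ face T.Ω (v j),
        ∀ z ∈ idealBdry T.C ∩ face T.Ω (v j),
          hilbertDist (face T.Ω (v j)) y z ≤ R := by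
  obtain ⟨E, hE, hmain⟩ := T.main hcdim
  refine ⟨(1 / 2) * Real.log E, by have := Real.log_pos hE; positivity, ?_⟩
  intro S v hv hSC hS j y hy z hz
  obtain ⟨a, ha, h012, h01, h02, h12⟩ := T.vertices hv hSC hS
  obtain ⟨haj, ha0, hav⟩ := ha j
  have haf := T.Q_f haj ha0
  have hvcl : v j ∈ closure T.Ω := by
    rw [← hav]; exact closure_mono T.C_sub ((T.mem_Q_iff ha0 haf).2 haj)
  have hNa : ∀ y ∈ idealBdry T.C ∩ face T.Ω (v j), cmap T.Ω y ∈ T.Q ∧ cmap T.Ω y ≠ 0 ∧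
      ∃ E', T.D.N E' (a j) (cmap T.Ω y) := by
    rintro y ⟨hy1, hy2⟩
    obtain ⟨hycl, E', hE'⟩ := (mem_face_iff T.pc hvcl).1 hy2
    have hy0 := cmap_ne T.pc hycl
    refine ⟨?_, hy0, E', ?_⟩
    · refine (T.mem_Q_iff hy0 ?_).1 ?_
      · rw [f_cmap T.pc hycl]; exact one_pos
      · rw [mk_cmap T.pc hycl]; exact hy1.1
    · rw [← hav, cmap_mk T.pc] at hE'
      have := hE'.smul_left haf
      rwa [smul_smul, mul_inv_cancel₀ haf.ne', one_smul] at this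
  obtain ⟨hyQ, hy0, hyN⟩ := hNa y hy
  obtain ⟨hzQ, hz0, hzN⟩ := hNa z hz
  refine (hilbert_face T.pc hvcl hy.2 hz.2).2 E hE.le ?_
  have key : ∀ i k : Fin 3, a j + a i + a k ∈ T.D.K0 → a j + a i ∉ T.D.K0 → a j + a k ∉ T.D.K0 →
      T.D.N E (cmap T.Ω y) (cmap T.Ω z) := fun i k h1 h2 h3 =>
    hmain _ haj _ (ha i).1 _ (ha k).1 _ hyQ _ hzQ h1 h2 h3 hy0 hz0 hyN hzN
  clear hmain
  rcases (show j = 0 ∨ j = 1 ∨ j = 2 by omega) with rfl | rfl | rfl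
  · exact key 1 2 h012 h01 h02
  · exact key 0 2 (by rwa [add_comm (a 1)]) (by rwa [add_comm]) h12
  · exact key 0 1 (by rwa [show a 2 + a 0 + a 1 = a 0 + a 1 + a 2 by abel]) (by rwa [add_comm])
      (by rwa [add_comm])

end Paper
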